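/- arXiv:math/0606145 — 2 statements merged into one kernel-verified Lean document; each statement's English description precedes it below -/
import Mathlib

section
/- There exist absolute constants ε₀ > 0 and C₀ > 0 with the following property. Let f(u) := u⁵ log(2+u²), and let u be a spherically symmetric classical solution of ∂ₜₜ u = Δu − f(u) on a compact time interval I × ℝ³ with endpoints t₀ < t₁. Define A := ∫_I ∫_{ℝ³} |u|⁸ log(2+|u|²) dx dt, B := Σ_{j=0}^{1} [ ( ∫_I ‖∇ₓʲ u(t)‖_{L^∞(ℝ³)}² dt )^{1/2} + sup_{t∈I} ‖∇_{t,x} ∇ₓʲ u(t)‖_{L²(ℝ³)} ], and D := ‖∇_{t,x} u(t₀)‖_{H¹(ℝ³)}. If A ≤ ε₀ / log(2+D), then B ≤ C₀ · D; in particular ‖∇_{t,x} u(t₁)‖_{H¹(ℝ³)} ≤ C₀ · ‖∇_{t,x} u(t₀)‖_{H¹(ℝ³)}. -/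
open MeasureTheory Real

noncomputable section

/-- Physical space `ℝ³`. -/
abbrev Sp : Type := EuclideanSpace ℝ (Fin 3)

/-- The partial derivative of `u : ℝ³ → ℝ` in the `i`-th coordinate direction. -/
noncomputable def pd (i : Fin 3) (u : Sp → ℝ) (x : Sp) : ℝ :=
  fderiv ℝ u x (EuclideanSpace.single i 1)

/-- The spatial Laplacian `Δu = ∑ i, ∂ᵢ∂ᵢ u`. -/
noncomputable def lap (u : Sp → ℝ) (x : Sp) : ℝ := ∑ i, pd i (pd i u) x

/-- The nonlinearity `f(u) = u⁵ log(2 + u²)`. -/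
noncomputable def nonlin (u : ℝ) : ℝ := u ^ 5 * Real.log (2 + u ^ 2)

/-- A classical solution of `∂ₜₜ u = Δu - f(u)` on `I × ℝ³`: a smooth function which is
compactly supported in space for each time `t ∈ I` and solves the equation pointwise on
`I × ℝ³`. -/
def IsClassicalSolution (I : Set ℝ) (u : ℝ → Sp → ℝ) : Prop :=
  ContDiff ℝ (⊤ : ℕ∞) (fun p : ℝ × Sp => u p.1 p.2) ∧
  (∀ t ∈ I, HasCompactSupport (u t)) ∧
  (∀ t ∈ I, ∀ x, deriv (deriv fun s => u s x) t = lap (u t) x - nonlin (u t x))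

/-- Spherical symmetry: `u(t,x)` depends only on `t` and `|x|`. -/
def IsRadialSolution (I : Set ℝ) (u : ℝ → Sp → ℝ) : Prop :=
  ∀ t ∈ I, ∀ x y : Sp, ‖x‖ = ‖y‖ → u t x = u t y

/-- `A = ∫_I ∫_{ℝ³} |u|⁸ log(2+|u|²) dx dt`. -/
noncomputable def Aquant (I : Set ℝ) (u : ℝ → Sp → ℝ) : ℝ :=
  ∫ t in I, ∫ x, |u t x| ^ 8 * Real.log (2 + (u t x) ^ 2)

/-- `D(t) = ‖∇_{t,x} u(t)‖_{H¹(ℝ³)}`, where the `H¹` norm squared of the space-time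
gradient `(∂ₜu, ∂₁u, ∂₂u, ∂₃u)` is the integral of the squares of its components together
with the squares of all their first spatial derivatives. -/
noncomputable def Dquant (u : ℝ → Sp → ℝ) (t : ℝ) : ℝ :=
  Real.sqrt (∫ x, ((deriv (fun s => u s x) t) ^ 2 + ∑ i, (pd i (u t) x) ^ 2
    + ∑ i, (pd i (fun y => deriv (fun s => u s y) t) x) ^ 2
    + ∑ i, ∑ j, (pd i (pd j (u t)) x) ^ 2))

/-- `B = ∑_{j=0}^{1} ( ‖∇ₓʲu‖_{L²ₜL^∞ₓ(I×ℝ³)} + ‖∇_{t,x}∇ₓʲu‖_{L^∞ₜL²ₓ(I×ℝ³)} )`. -/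
noncomputable def Bquant (I : Set ℝ) (u : ℝ → Sp → ℝ) : ℝ :=
  (Real.sqrt (∫ t in I, (⨆ x, |u t x|) ^ 2)
    + ⨆ t ∈ I, Real.sqrt (∫ x, ((deriv (fun s => u s x) t) ^ 2 + ∑ i, (pd i (u t) x) ^ 2)))
  + (Real.sqrt (∫ t in I, (⨆ x, Real.sqrt (∑ i, (pd i (u t) x) ^ 2)) ^ 2)
    + ⨆ t ∈ I, Real.sqrt (∫ x, (∑ i, (deriv (fun s => pd i (u s) x) t) ^ 2
        + ∑ i, ∑ j, (pd j (pd i (u t)) x) ^ 2)))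

/-- A smooth function of two real variables, in curried form. -/
def Smooth₂ (g : ℝ → ℝ → ℝ) : Prop := ContDiff ℝ (⊤ : ℕ∞) fun p : ℝ × ℝ => g p.1 p.2

/-- The partial derivative in the first (time) variable. -/
def dt (g : ℝ → ℝ → ℝ) (t r : ℝ) : ℝ := deriv (fun s => g s r) t

/-- The partial derivative in the second (space) variable. -/
def dr (g : ℝ → ℝ → ℝ) (t r : ℝ) : ℝ := deriv (g t) r

theorem ContDiff.directional_deriv {V : Type*} [NormedAddCommGroup V] [NormedSpace ℝ V]
    {F : V → ℝ} (hF : ContDiff ℝ (⊤ : ℕ∞) F) (v : V) :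
    ContDiff ℝ (⊤ : ℕ∞) fun x => fderiv ℝ F x v :=
  (hF.fderiv_right (m := (⊤ : ℕ∞)) (by simp)).clm_apply contDiff_const

theorem ContDiff.differentiable_top {V : Type*} [NormedAddCommGroup V] [NormedSpace ℝ V]
    {F : V → ℝ} (hF : ContDiff ℝ (⊤ : ℕ∞) F) : Differentiable ℝ F :=
  hF.differentiable (by simp)

theorem ContDiff.directional_deriv_comm {V : Type*} [NormedAddCommGroup V] [NormedSpace ℝ V]
    {F : V → ℝ} (hF : ContDiff ℝ (⊤ : ℕ∞) F) (v w x : V) :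
    fderiv ℝ (fun y => fderiv ℝ F y v) x w = fderiv ℝ (fun y => fderiv ℝ F y w) x v := by
  have hd : Differentiable ℝ (fderiv ℝ F) :=
    (hF.fderiv_right (m := (⊤ : ℕ∞)) (by simp)).differentiable (by simp)
  have key : ∀ a b : V, fderiv ℝ (fun y => fderiv ℝ F y a) x b = fderiv ℝ (fderiv ℝ F) x b a := by
    intro a b
    rw [fderiv_clm_apply (hd x) (differentiableAt_const a)]
    simp
  rw [key, key]
  exact second_derivative_symmetric (fun y => (hF.differentiable_top y).hasFDerivAt)
    (hd x).hasFDerivAt w v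

namespace Smooth₂

variable {g : ℝ → ℝ → ℝ}

theorem hasFDerivAt (hg : Smooth₂ g) (p : ℝ × ℝ) :
    HasFDerivAt (fun p : ℝ × ℝ => g p.1 p.2)
      (fderiv ℝ (fun p : ℝ × ℝ => g p.1 p.2) p) p :=
  (ContDiff.differentiable_top hg p).hasFDerivAt

theorem hasDerivAt_line (hg : Smooth₂ g) (a b c d t : ℝ) :
    HasDerivAt (fun s => g (a + b * s) (c + d * s))
      (fderiv ℝ (fun p : ℝ × ℝ => g p.1 p.2) (a + b * t, c + d * t) (b, d)) t := by
  have h1 : HasDerivAt (fun s : ℝ => ((a + b * s, c + d * s) : ℝ × ℝ)) (b, d) t := by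
    refine HasDerivAt.prodMk ?_ ?_
    · simpa using ((hasDerivAt_id t).const_mul b).const_add a
    · simpa using ((hasDerivAt_id t).const_mul d).const_add c
  exact (hg.hasFDerivAt (a + b * t, c + d * t)).comp_hasDerivAt t h1

theorem dt_eq (hg : Smooth₂ g) (t r : ℝ) :
    dt g t r = fderiv ℝ (fun p : ℝ × ℝ => g p.1 p.2) (t, r) (1, 0) := by
  simpa [dt] using (hg.hasDerivAt_line 0 1 r 0 t).deriv

theorem dr_eq (hg : Smooth₂ g) (t r : ℝ) :
    dr g t r = fderiv ℝ (fun p : ℝ × ℝ => g p.1 p.2) (t, r) (0, 1) := by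
  simpa [dr] using (hg.hasDerivAt_line t 0 0 1 r).deriv

theorem hasDerivAt_dt (hg : Smooth₂ g) (t r : ℝ) :
    HasDerivAt (fun s => g s r) (dt g t r) t := by
  rw [hg.dt_eq]
  simpa using hg.hasDerivAt_line 0 1 r 0 t

theorem hasDerivAt_dr (hg : Smooth₂ g) (t r : ℝ) : HasDerivAt (g t) (dr g t r) r := by
  rw [hg.dr_eq]
  simpa using hg.hasDerivAt_line t 0 0 1 r

theorem hasDerivAt_comp_line (hg : Smooth₂ g) (a b c d t : ℝ) :
    HasDerivAt (fun s => g (a + b * s) (c + d * s))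
      (b * dt g (a + b * t) (c + d * t) + d * dr g (a + b * t) (c + d * t)) t := by
  convert hg.hasDerivAt_line a b c d t using 1
  rw [hg.dt_eq, hg.dr_eq]
  have h : ((b, d) : ℝ × ℝ) = b • (1, 0) + d • (0, 1) := by simp
  rw [h, map_add, map_smul, map_smul, smul_eq_mul, smul_eq_mul]

theorem dt (hg : Smooth₂ g) : Smooth₂ (dt g) := by
  have h : (fun p : ℝ × ℝ => _root_.dt g p.1 p.2)
      = fun p => fderiv ℝ (fun p : ℝ × ℝ => g p.1 p.2) p (1, 0) :=
    funext fun p => hg.dt_eq p.1 p.2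
  rw [Smooth₂, h]
  exact ContDiff.directional_deriv hg (1, 0)

theorem dr (hg : Smooth₂ g) : Smooth₂ (dr g) := by
  have h : (fun p : ℝ × ℝ => _root_.dr g p.1 p.2)
      = fun p => fderiv ℝ (fun p : ℝ × ℝ => g p.1 p.2) p (0, 1) :=
    funext fun p => hg.dr_eq p.1 p.2
  rw [Smooth₂, h]
  exact ContDiff.directional_deriv hg (0, 1)

theorem dt_dr (hg : Smooth₂ g) : _root_.dt (_root_.dr g) = _root_.dr (_root_.dt g) := by
  funext t r
  have h1 : (fun p : ℝ × ℝ => _root_.dt g p.1 p.2)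
      = fun p => fderiv ℝ (fun p : ℝ × ℝ => g p.1 p.2) p (1, 0) :=
    funext fun p => hg.dt_eq p.1 p.2
  have h2 : (fun p : ℝ × ℝ => _root_.dr g p.1 p.2)
      = fun p => fderiv ℝ (fun p : ℝ × ℝ => g p.1 p.2) p (0, 1) :=
    funext fun p => hg.dr_eq p.1 p.2
  rw [hg.dr.dt_eq, hg.dt.dr_eq, h1, h2]
  exact ContDiff.directional_deriv_comm hg (0, 1) (1, 0) (t, r)

theorem continuous (hg : Smooth₂ g) : Continuous fun p : ℝ × ℝ => g p.1 p.2 :=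
  ContDiff.continuous hg

theorem continuous_comp {X : Type*} [TopologicalSpace X] (hg : Smooth₂ g) {a b : X → ℝ}
    (ha : Continuous a) (hb : Continuous b) : Continuous fun x => g (a x) (b x) :=
  hg.continuous.comp (ha.prodMk hb)

theorem add {k : ℝ → ℝ → ℝ} (hg : Smooth₂ g) (hk : Smooth₂ k) :
    Smooth₂ fun t r => g t r + k t r := ContDiff.add hg hk

theorem mul {k : ℝ → ℝ → ℝ} (hg : Smooth₂ g) (hk : Smooth₂ k) :
    Smooth₂ fun t r => g t r * k t r := ContDiff.mul hg hk

theorem snd : Smooth₂ fun _ r => r := contDiff_snd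

theorem comp_left {f : ℝ → ℝ} (hf : ContDiff ℝ (⊤ : ℕ∞) f) (hg : Smooth₂ g) :
    Smooth₂ fun t r => f (g t r) := hf.comp hg

/-- Integrating a transport equation along its characteristics. -/
theorem eq_add_integral_characteristic (hg : Smooth₂ g) (a b y : ℝ) :
    g b (y - b) = g a (y - a)
      + ∫ s in a..b, (_root_.dt g s (y - s) - _root_.dr g s (y - s)) := by
  have h1 : ∀ s ∈ Set.uIcc a b, HasDerivAt (fun s => g s (y - s))
      (_root_.dt g s (y - s) - _root_.dr g s (y - s)) s := by
    intro s _
    have := hg.hasDerivAt_comp_line 0 1 y (-1) s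
    simpa [sub_eq_add_neg] using this
  rw [intervalIntegral.integral_eq_sub_of_hasDerivAt h1]
  · ring
  · apply Continuous.intervalIntegrable
    exact (hg.dt.continuous_comp continuous_id (continuous_const.sub continuous_id)).sub
      (hg.dr.continuous_comp continuous_id (continuous_const.sub continuous_id))

end Smooth₂

/-- The average of `G` over the interval of centre `t` and half-length `|r|`. -/
def avg (G : ℝ → ℝ) (t r : ℝ) : ℝ := 1 / 2 * ∫ σ in (-1 : ℝ)..1, G (t + r * σ)

/-- The centred Hardy–Littlewood maximal function of a nonnegative function on the line. -/
def maxFn (G : ℝ → ℝ) (t : ℝ) : ℝ := ⨆ r : ℝ, avg G t r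

section Maximal

variable {G : ℝ → ℝ} {b : ℝ}

theorem continuous_avg (hG : Continuous G) : Continuous fun p : ℝ × ℝ => avg G p.1 p.2 := by
  refine continuous_const.mul ?_
  apply intervalIntegral.continuous_parametric_intervalIntegral_of_continuous'
  fun_prop

theorem avg_mono {H : ℝ → ℝ} (hG : Continuous G) (hH : Continuous H) {t r : ℝ}
    (h : ∀ σ ∈ Set.Icc (-1 : ℝ) 1, G (t + r * σ) ≤ H (t + r * σ)) : avg G t r ≤ avg H t r := by
  refine mul_le_mul_of_nonneg_left ?_ (by norm_num)
  exact intervalIntegral.integral_mono_on (by norm_num)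
    (Continuous.intervalIntegrable (by fun_prop) _ _)
    (Continuous.intervalIntegrable (by fun_prop) _ _) h

theorem avg_const (c t r : ℝ) : avg (fun _ => c) t r = c := by
  simp [avg]; ring

theorem avg_nonneg (h0 : ∀ x, 0 ≤ G x) (t r : ℝ) : 0 ≤ avg G t r :=
  mul_nonneg (by norm_num)
    (intervalIntegral.integral_nonneg (by norm_num) fun σ _ => h0 _)

theorem avg_le (hG : Continuous G) (hb : ∀ x, G x ≤ b) (t r : ℝ) : avg G t r ≤ b := by
  refine (avg_mono hG continuous_const fun σ _ => hb _).trans_eq (avg_const b t r)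

theorem avg_le_maxFn (hG : Continuous G) (hb : ∀ x, G x ≤ b) (t r : ℝ) :
    avg G t r ≤ maxFn G t :=
  le_ciSup (f := fun r => avg G t r) ⟨b, by rintro _ ⟨r, rfl⟩; exact avg_le hG hb t r⟩ r

theorem maxFn_nonneg (h0 : ∀ x, 0 ≤ G x) (t : ℝ) : 0 ≤ maxFn G t :=
  Real.iSup_nonneg fun r => avg_nonneg h0 t r

theorem measurable_maxFn (hG : Continuous G) (hb : ∀ x, G x ≤ b) : Measurable (maxFn G) := by
  apply LowerSemicontinuous.measurable
  refine lowerSemicontinuous_ciSup (f := fun r t => avg G t r) ?_ ?_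
  · exact fun t => ⟨b, by rintro _ ⟨r, rfl⟩; exact avg_le hG hb t r⟩
  · intro r
    exact ((continuous_avg hG).comp (Continuous.prodMk_left r)).lowerSemicontinuous

theorem avg_neg (t r : ℝ) : avg G t (-r) = avg G t r := by
  unfold avg
  have := intervalIntegral.integral_comp_neg (a := -1) (b := 1) (fun σ => G (t + r * σ))
  simp only [neg_neg] at this
  rw [← this]
  simp [neg_mul]

theorem mul_avg (t r : ℝ) :
    2 * r * avg G t r = ∫ x in (t - r)..(t + r), G x := by
  unfold avg
  have := intervalIntegral.smul_integral_comp_add_mul (a := -1) (b := 1) G r t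
  rw [smul_eq_mul] at this
  calc _ = r * ∫ σ in (-1 : ℝ)..1, G (t + r * σ) := by ring
    _ = _ := by rw [this]; congr 1; ring; ring

theorem exists_pos_lt_avg (hG : Continuous G) {t c : ℝ} (h : c < maxFn G t) :
    ∃ r > 0, c < avg G t r := by
  obtain ⟨r, hr⟩ := exists_lt_of_lt_ciSup h
  have ho : IsOpen {r | c < avg G t r} :=
    isOpen_lt continuous_const ((continuous_avg hG).comp (Continuous.prodMk_right t))
  obtain ⟨r', hr', hne⟩ := (dense_compl_singleton (0 : ℝ)).inter_open_nonempty _ ho ⟨r, hr⟩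
  refine ⟨|r'|, abs_pos.2 hne, ?_⟩
  rcases abs_choice r' with h | h <;> rw [h]
  · exact hr'
  · rw [avg_neg]; exact hr'

theorem ofReal_mul_le_lintegral_closedBall (hG : Continuous G) {t c r : ℝ}
    (hr : 0 < r) (h : c < avg G t r) :
    ENNReal.ofReal (c * r) ≤
      ∫⁻ x in Metric.closedBall t r, ENNReal.ofReal (G x - c / 2) := by
  have h1 : c / 2 ≤ avg (fun x => max (G x - c / 2) 0) t r := by
    have h2 : avg G t r ≤ avg (fun x => max (G x - c / 2) 0 + c / 2) t r := by
      refine avg_mono hG (by fun_prop) fun σ _ => ?_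
      have := le_max_left (G (t + r * σ) - c / 2) 0
      linarith
    have h3 : avg (fun x => max (G x - c / 2) 0 + c / 2) t r
        = avg (fun x => max (G x - c / 2) 0) t r + avg (fun _ => c / 2) t r := by
      unfold avg
      rw [intervalIntegral.integral_add]
      · ring
      · exact Continuous.intervalIntegrable (by fun_prop) _ _
      · exact Continuous.intervalIntegrable (by fun_prop) _ _
    rw [avg_const] at h3
    linarith
  have h4 : c * r ≤ ∫ x in Metric.closedBall t r, max (G x - c / 2) 0 := by
    have := mul_avg (G := fun x => max (G x - c / 2) 0) t r
    rw [intervalIntegral.integral_of_le (by linarith), ← integral_Icc_eq_integral_Ioc,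
      ← Real.closedBall_eq_Icc] at this
    rw [← this]
    nlinarith
  refine (ENNReal.ofReal_le_ofReal h4).trans ?_
  rw [ofReal_integral_eq_lintegral_ofReal]
  · refine lintegral_mono fun x => ?_
    simp [ENNReal.ofReal_max]
  · exact (Continuous.continuousOn (by fun_prop)).integrableOn_compact
      (isCompact_closedBall t r)
  · exact Filter.Eventually.of_forall fun x => le_max_right _ _

/-- The weak-type inequality for the maximal function. -/
theorem volume_lt_maxFn_le (hG : Continuous G) {c : ℝ} (hc : 0 < c) :
    volume {t | c < maxFn G t} ≤
      ENNReal.ofReal (10 / c) * ∫⁻ x, ENNReal.ofReal (G x - c / 2) := by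
  by_cases hI : ∫⁻ x, ENNReal.ofReal (G x - c / 2) = ⊤
  · rw [hI, ENNReal.mul_top (by simpa using hc)]
    exact le_top
  set S := {t | c < maxFn G t}
  choose! ρ hρ0 hρ using fun t (ht : t ∈ S) => exists_pos_lt_avg hG ht
  have hball : ∀ t ∈ S, ENNReal.ofReal (c * ρ t) ≤
      ∫⁻ x in Metric.closedBall t (ρ t), ENNReal.ofReal (G x - c / 2) := fun t ht =>
    ofReal_mul_le_lintegral_closedBall hG (hρ0 t ht) (hρ t ht)
  have hbd : ∀ t ∈ S, ρ t ≤ (∫⁻ x, ENNReal.ofReal (G x - c / 2)).toReal / c := by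
    intro t ht
    rw [le_div_iff₀ hc, mul_comm]
    rw [← ENNReal.ofReal_le_iff_le_toReal hI]
    exact (hball t ht).trans (setLIntegral_le_lintegral _ _)
  obtain ⟨v, hvS, hdis, hcov⟩ := Vitali.exists_disjoint_subfamily_covering_enlargement_closedBall
    S id ρ _ hbd 5 (by norm_num)
  have hvc : v.Countable := hdis.countable_of_nonempty_interior fun t ht => by
    rw [interior_closedBall _ (hρ0 t (hvS ht)).ne']
    exact Metric.nonempty_ball.2 (hρ0 t (hvS ht))
  calc volume S ≤ volume (⋃ t ∈ v, Metric.closedBall t (5 * ρ t)) := by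
        refine measure_mono fun t ht => ?_
        obtain ⟨b, hb, hsub⟩ := hcov t ht
        exact Set.mem_biUnion hb (hsub (Metric.mem_closedBall_self (hρ0 t ht).le))
    _ ≤ ∑' t : v, volume (Metric.closedBall (t : ℝ) (5 * ρ t)) := measure_biUnion_le _ hvc _
    _ ≤ ∑' t : v, ENNReal.ofReal (10 / c) *
          ∫⁻ x in Metric.closedBall (t : ℝ) (ρ t), ENNReal.ofReal (G x - c / 2) := by
        refine ENNReal.tsum_le_tsum fun t => ?_
        refine le_trans ?_ (mul_le_mul_right (hball t (hvS t.2)) _)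
        rw [Real.volume_closedBall, ← ENNReal.ofReal_mul (by positivity)]
        refine ENNReal.ofReal_le_ofReal (le_of_eq ?_)
        field_simp
        ring
    _ = ENNReal.ofReal (10 / c) *
          ∫⁻ x in ⋃ t ∈ v, Metric.closedBall t (ρ t), ENNReal.ofReal (G x - c / 2) := by
        rw [ENNReal.tsum_mul_left, lintegral_biUnion (s := fun t => Metric.closedBall t (ρ t))
          hvc (fun t _ => Metric.isClosed_closedBall.measurableSet) hdis]
    _ ≤ _ := mul_le_mul_right (setLIntegral_le_lintegral _ _) _

theorem lintegral_ofReal_sub_half {a : ℝ} (ha : 0 ≤ a) :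
    ∫⁻ c in Set.Ioi (0 : ℝ), ENNReal.ofReal (a - c / 2) = ENNReal.ofReal (a ^ 2) := by
  have h1 : ∫⁻ c in Set.Ioi (0 : ℝ), ENNReal.ofReal (a - c / 2)
      = ∫⁻ c in Set.Ioc (0 : ℝ) (2 * a), ENNReal.ofReal (a - c / 2) := by
    rw [← Set.Ioc_union_Ioi_eq_Ioi (by positivity : 0 ≤ 2 * a),
      lintegral_union measurableSet_Ioi (Set.Ioc_disjoint_Ioi le_rfl)]
    rw [setLIntegral_congr_fun (g := fun _ => 0) measurableSet_Ioi]
    · simp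
    · intro c hc
      have : 2 * a < c := hc
      exact ENNReal.ofReal_of_nonpos (by linarith)
  rw [h1, ← ofReal_integral_eq_lintegral_ofReal]
  · rw [← intervalIntegral.integral_of_le (by positivity)]
    congr 1
    rw [intervalIntegral.integral_sub (by simp)
      (Continuous.intervalIntegrable (by fun_prop) _ _)]
    simp [integral_id]
    ring
  · exact (Continuous.intervalIntegrable (by fun_prop) _ _).1
  · refine (ae_restrict_iff' measurableSet_Ioc).2 (Filter.Eventually.of_forall fun c hc => ?_)
    have := hc.2
    simp only [Pi.zero_apply]
    linarith

/-- The `L²` bound for the maximal function. -/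
theorem lintegral_maxFn_sq_le (hG : Continuous G) (h0 : ∀ x, 0 ≤ G x) (hb : ∀ x, G x ≤ b) :
    ∫⁻ t, ENNReal.ofReal (maxFn G t ^ 2) ≤ 20 * ∫⁻ x, ENNReal.ofReal (G x ^ 2) := by
  have hl := lintegral_rpow_eq_lintegral_meas_lt_mul volume (f := maxFn G)
    (Filter.Eventually.of_forall fun t => maxFn_nonneg h0 t)
    (measurable_maxFn hG hb).aemeasurable (p := 2) (by norm_num)
  simp only [rpow_two] at hl
  rw [hl]
  calc _ ≤ ENNReal.ofReal 2 * ∫⁻ c in Set.Ioi (0 : ℝ),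
          10 * ∫⁻ x, ENNReal.ofReal (G x - c / 2) := by
        refine mul_le_mul_right (setLIntegral_mono' measurableSet_Ioi fun c hc => ?_) _
        have hc : 0 < c := hc
        refine (mul_le_mul_left (volume_lt_maxFn_le hG hc) _).trans (le_of_eq ?_)
        rw [mul_right_comm, ← ENNReal.ofReal_mul (by positivity)]
        congr 1
        norm_num
        rw [div_mul_cancel₀ _ hc.ne']
    _ = 20 * ∫⁻ c in Set.Ioi (0 : ℝ), ∫⁻ x, ENNReal.ofReal (G x - c / 2) := by
        rw [lintegral_const_mul' _ _ (by norm_num), ← mul_assoc]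
        norm_num
    _ = 20 * ∫⁻ x, ∫⁻ c in Set.Ioi (0 : ℝ), ENNReal.ofReal (G x - c / 2) := by
        rw [lintegral_lintegral_swap]
        apply Measurable.aemeasurable
        apply ENNReal.measurable_ofReal.comp
        have : Continuous (Function.uncurry fun (c x : ℝ) => G x - c / 2) := by
          unfold Function.uncurry; fun_prop
        exact this.measurable
    _ = _ := by simp_rw [lintegral_ofReal_sub_half (h0 _)]

end Maximal

/-- The Cauchy–Schwarz inequality for nonnegative square-integrable functions. -/
theorem integral_mul_le_sqrt_mul_sqrt {α : Type*} [MeasurableSpace α] {μ : Measure α}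
    {f g : α → ℝ} (hf0 : ∀ x, 0 ≤ f x) (hg0 : ∀ x, 0 ≤ g x) (hf : MemLp f 2 μ)
    (hg : MemLp g 2 μ) :
    ∫ x, f x * g x ∂μ ≤ √(∫ x, f x ^ 2 ∂μ) * √(∫ x, g x ^ 2 ∂μ) := by
  have h := integral_mul_le_Lp_mul_Lq_of_nonneg (μ := μ) Real.HolderConjugate.two_two
    (Filter.Eventually.of_forall hf0) (Filter.Eventually.of_forall hg0)
    (by simpa using hf) (by simpa using hg)
  simpa [Real.sqrt_eq_rpow] using h

/-- The real-valued `L²` norm on the line. -/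
def n2 (g : ℝ → ℝ) : ℝ := √(∫ x, g x ^ 2)

/-- Vanishing outside the interval `(-R, R)`. -/
def VanishesOff (R : ℝ) (g : ℝ → ℝ) : Prop := ∀ x, R ≤ |x| → g x = 0

theorem n2_nonneg (g : ℝ → ℝ) : 0 ≤ n2 g := Real.sqrt_nonneg _

theorem n2_sq (g : ℝ → ℝ) : n2 g ^ 2 = ∫ x, g x ^ 2 :=
  Real.sq_sqrt (integral_nonneg fun _ => sq_nonneg _)

theorem n2_abs (g : ℝ → ℝ) : n2 (fun x => |g x|) = n2 g := by simp [n2]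

theorem n2_comp_sub (g : ℝ → ℝ) (s : ℝ) : n2 (fun x => g (x - s)) = n2 g := by
  unfold n2
  rw [integral_sub_right_eq_self (fun x => g x ^ 2) s]

namespace VanishesOff

variable {R : ℝ} {g k : ℝ → ℝ}

theorem hasCompactSupport (h : VanishesOff R g) : HasCompactSupport g :=
  HasCompactSupport.intro (isCompact_closedBall (0 : ℝ) R) fun x hx => h x <| by
    rw [Metric.mem_closedBall, dist_zero_right, not_le] at hx
    exact hx.le

theorem sq (h : VanishesOff R g) : VanishesOff R fun x => g x ^ 2 := fun x hx => by
  simp [h x hx]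

theorem mul_left (h : VanishesOff R g) : VanishesOff R fun x => k x * g x := fun x hx => by
  simp [h x hx]

theorem mul_right (h : VanishesOff R g) : VanishesOff R fun x => g x * k x := fun x hx => by
  simp [h x hx]

theorem integrable (h : VanishesOff R g) (hc : Continuous g) : Integrable g :=
  hc.integrable_of_hasCompactSupport h.hasCompactSupport

theorem memLp (h : VanishesOff R g) (hc : Continuous g) : MemLp g 2 :=
  hc.memLp_of_hasCompactSupport h.hasCompactSupport

theorem integral_eq (h : VanishesOff R g) : ∫ x, g x = ∫ x in (-R)..R, g x := by
  rw [intervalIntegral.integral_eq_integral_of_support_subset]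
  intro x hx
  by_contra hx'
  refine hx (h x ?_)
  simp only [Set.mem_Ioc, not_and_or, not_lt, not_le] at hx'
  rcases hx' with hx' | hx'
  · exact le_abs.2 (Or.inr (by linarith))
  · exact le_abs.2 (Or.inl hx'.le)

theorem exists_bound (h : VanishesOff R g) (hc : Continuous g) : ∃ b, ∀ x, g x ≤ b := by
  obtain ⟨b, hb⟩ := h.hasCompactSupport.exists_bound_of_continuous hc
  exact ⟨b, fun x => (le_abs_self _).trans (hb x)⟩

end VanishesOff

theorem integral_mul_le_n2_mul_n2 {R : ℝ} {f g : ℝ → ℝ} (hf0 : ∀ x, 0 ≤ f x)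
    (hg0 : ∀ x, 0 ≤ g x) (hf : Continuous f) (hg : Continuous g) (hfR : VanishesOff R f)
    (hgR : VanishesOff R g) : ∫ x, f x * g x ≤ n2 f * n2 g :=
  integral_mul_le_sqrt_mul_sqrt hf0 hg0 (hfR.memLp hf) (hgR.memLp hg)

theorem continuousOn_n2 {k : ℝ → ℝ → ℝ} {R : ℝ} {I : Set ℝ}
    (hk : Continuous fun p : ℝ × ℝ => k p.1 p.2) (hkR : ∀ t ∈ I, VanishesOff R (k t)) :
    ContinuousOn (fun t => n2 (k t)) I := by
  have h : ∀ t ∈ I, n2 (k t) = √(∫ x in (-R)..R, k t x ^ 2) := fun t ht => by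
    rw [n2, (hkR t ht).sq.integral_eq]
  refine ContinuousOn.congr (Continuous.continuousOn ?_) h
  apply Continuous.sqrt
  apply intervalIntegral.continuous_parametric_intervalIntegral_of_continuous'
  exact (hk.pow 2 : _)

/-- The envelope along characteristics of a solution to `(∂ₜ - ∂ᵣ) p = -k` on `[a, T]`. -/
def envelope (p k : ℝ → ℝ → ℝ) (a T y : ℝ) : ℝ :=
  |p a (y - a)| + ∫ s in a..T, |k s (y - s)|

section Transport

variable {p k : ℝ → ℝ → ℝ} {a T R : ℝ}

theorem continuous_shift (hk : Continuous fun p : ℝ × ℝ => k p.1 p.2) :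
    Continuous fun z : ℝ × ℝ => |k z.1 (z.2 - z.1)| :=
  (hk.comp (continuous_fst.prodMk (continuous_snd.sub continuous_fst))).abs

theorem continuous_envelope (hp : Continuous fun z : ℝ × ℝ => p z.1 z.2)
    (hk : Continuous fun z : ℝ × ℝ => k z.1 z.2) : Continuous (envelope p k a T) := by
  refine Continuous.add ?_ ?_
  · exact (hp.comp (continuous_const.prodMk (continuous_id.sub continuous_const))).abs
  · apply intervalIntegral.continuous_parametric_intervalIntegral_of_continuous'
    exact (continuous_shift hk).comp continuous_swap

theorem envelope_nonneg (hT : a ≤ T) (y : ℝ) : 0 ≤ envelope p k a T y :=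
  add_nonneg (abs_nonneg _) (intervalIntegral.integral_nonneg hT fun _ _ => abs_nonneg _)

theorem le_abs_sub_of_mem {s y : ℝ} (hs : s ∈ Set.Icc a T) (hy : R + |a| + |T| ≤ |y|) :
    R ≤ |y - s| := by
  have h1 : |s| ≤ |a| + |T| := by
    refine abs_le.2 ⟨?_, ?_⟩
    · linarith [hs.1, neg_abs_le a, abs_nonneg T]
    · linarith [hs.2, le_abs_self T, abs_nonneg a]
  have := abs_sub_abs_le_abs_sub y s
  linarith

theorem vanishesOff_envelope (hT : a ≤ T) (hp : ∀ t ∈ Set.Icc a T, VanishesOff R (p t))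
    (hk : ∀ t ∈ Set.Icc a T, VanishesOff R (k t)) :
    VanishesOff (R + |a| + |T|) (envelope p k a T) := by
  intro y hy
  have h2 : ∫ s in a..T, |k s (y - s)| = ∫ s in a..T, (0 : ℝ) := by
    refine intervalIntegral.integral_congr fun s hs => ?_
    rw [Set.uIcc_of_le hT] at hs
    simp [hk s hs _ (le_abs_sub_of_mem hs hy)]
  have ha : a ∈ Set.Icc a T := ⟨le_rfl, hT⟩
  rw [envelope, h2, hp a ha _ (le_abs_sub_of_mem ha hy)]
  simp

theorem n2_envelope_le (hT : a ≤ T) (hR : 0 ≤ R)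
    (hpc : Continuous fun z : ℝ × ℝ => p z.1 z.2) (hkc : Continuous fun z : ℝ × ℝ => k z.1 z.2)
    (hp : ∀ t ∈ Set.Icc a T, VanishesOff R (p t)) (hk : ∀ t ∈ Set.Icc a T, VanishesOff R (k t)) :
    n2 (envelope p k a T) ≤ n2 (p a) + ∫ s in a..T, n2 (k s) := by
  set G := envelope p k a T with hGdef
  set M := R + |a| + |T| with hM
  have hM0 : 0 ≤ M := by positivity
  have hGc : Continuous G := continuous_envelope hpc hkc
  have hG0 : ∀ y, 0 ≤ G y := envelope_nonneg hT
  have hGM : VanishesOff M G := vanishesOff_envelope hT hp hk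
  have hkM : ∀ s ∈ Set.Icc a T, VanishesOff M fun y => |k s (y - s)| := fun s hs y hy => by
    simp [hk s hs _ (le_abs_sub_of_mem hs hy)]
  have hsh := continuous_shift hkc
  have hpa : Continuous fun y => |p a (y - a)| :=
    (hpc.comp (continuous_const.prodMk (continuous_id.sub continuous_const))).abs
  have hks : ∀ s, Continuous fun y => |k s (y - s)| := fun s => hsh.comp (Continuous.prodMk_right s)
  have hswap : ∫ y, G y * ∫ s in a..T, |k s (y - s)|
      = ∫ s in a..T, ∫ y, G y * |k s (y - s)| := by
    rw [(hGM.mul_right (k := fun y => ∫ s in a..T, |k s (y - s)|)).integral_eq]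
    have h1 : ∫ s in a..T, ∫ y, G y * |k s (y - s)|
        = ∫ s in a..T, ∫ y in Set.Ioc (-M) M, G y * |k s (y - s)| := by
      refine intervalIntegral.integral_congr fun s _ => ?_
      rw [(hGM.mul_right (k := fun y => |k s (y - s)|)).integral_eq,
        intervalIntegral.integral_of_le (by linarith)]
    rw [h1, intervalIntegral_integral_swap, intervalIntegral.integral_of_le (by linarith)]
    · simp_rw [intervalIntegral.integral_const_mul]
    · rw [Measure.prod_restrict, Set.uIoc_of_le hT]
      refine IntegrableOn.mono_set (t := Set.Icc a T ×ˢ Set.Icc (-M) M) ?_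
        (Set.prod_mono Set.Ioc_subset_Icc_self Set.Ioc_subset_Icc_self)
      refine ContinuousOn.integrableOn_compact (isCompact_Icc.prod isCompact_Icc)
        (Continuous.continuousOn ?_)
      exact (hGc.comp continuous_snd).mul hsh
  have ha : a ∈ Set.Icc a T := ⟨le_rfl, hT⟩
  have hpM : VanishesOff M fun y => |p a (y - a)| := fun y hy => by
    simp [hp a ha _ (le_abs_sub_of_mem ha hy)]
  have hsq : n2 G ^ 2 ≤ n2 G * (n2 (p a) + ∫ s in a..T, n2 (k s)) := by
    calc n2 G ^ 2 = ∫ y, (G y * |p a (y - a)| + G y * ∫ s in a..T, |k s (y - s)|) := by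
          rw [n2_sq]
          refine integral_congr_ae (Filter.Eventually.of_forall fun y => ?_)
          simp only
          rw [← mul_add, pow_two, hGdef]
          rfl
      _ = (∫ y, G y * |p a (y - a)|) + ∫ y, G y * ∫ s in a..T, |k s (y - s)| := by
          refine integral_add ?_ ?_
          · exact (hGM.mul_right).integrable (hGc.mul hpa)
          · refine (hGM.mul_right).integrable (hGc.mul ?_)
            apply intervalIntegral.continuous_parametric_intervalIntegral_of_continuous'
            exact hsh.comp continuous_swap
      _ ≤ n2 G * n2 (p a) + ∫ s in a..T, n2 G * n2 (k s) := by
          rw [hswap]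
          refine add_le_add ?_ ?_
          · refine (integral_mul_le_n2_mul_n2 hG0 (fun _ => abs_nonneg _) hGc hpa hGM hpM).trans ?_
            rw [n2_abs (fun y => p a (y - a)), n2_comp_sub]
          · refine intervalIntegral.integral_mono_on hT ?_ ?_ ?_
            · refine Continuous.intervalIntegrable ?_ _ _
              have : ∀ s, ∫ y, G y * |k s (y - s)| = ∫ y in (-M)..M, G y * |k s (y - s)| :=
                fun s => (hGM.mul_right (k := fun y => |k s (y - s)|)).integral_eq
              simp_rw [this]
              apply intervalIntegral.continuous_parametric_intervalIntegral_of_continuous'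
              exact (hGc.comp continuous_snd).mul hsh
            · refine ContinuousOn.intervalIntegrable ?_
              rw [Set.uIcc_of_le hT]
              exact continuousOn_const.mul (continuousOn_n2 hkc hk)
            · intro s hs
              refine (integral_mul_le_n2_mul_n2 hG0 (fun _ => abs_nonneg _) hGc (hks s) hGM
                (hkM s hs)).trans ?_
              rw [n2_abs (fun y => k s (y - s)), n2_comp_sub]
      _ = _ := by rw [intervalIntegral.integral_const_mul]; ring
  rcases (n2_nonneg G).eq_or_lt with h | h
  · rw [← h]
    exact add_nonneg (n2_nonneg _) (intervalIntegral.integral_nonneg hT fun s _ => n2_nonneg _)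
  · rw [pow_two] at hsq
    exact le_of_mul_le_mul_left hsq h

theorem abs_le_envelope (hpS : Smooth₂ p) (hkc : Continuous fun z : ℝ × ℝ => k z.1 z.2)
    (heq : ∀ t ∈ Set.Icc a T, ∀ r, dt p t r - dr p t r = -k t r) {t : ℝ}
    (ht : t ∈ Set.Icc a T) (r : ℝ) : |p t r| ≤ envelope p k a T (r + t) := by
  have hks : Continuous fun s => |k s (r + t - s)| :=
    (continuous_shift hkc).comp (Continuous.prodMk_left (r + t))
  have h := hpS.eq_add_integral_characteristic a t (r + t)
  have h1 : ∫ s in a..t, (dt p s (r + t - s) - dr p s (r + t - s))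
      = ∫ s in a..t, -k s (r + t - s) := by
    refine intervalIntegral.integral_congr fun s hs => ?_
    rw [Set.uIcc_of_le ht.1] at hs
    exact heq s ⟨hs.1, hs.2.trans ht.2⟩ _
  rw [h1, add_sub_cancel_right] at h
  rw [h]
  refine (abs_add_le _ _).trans (add_le_add_right ?_ _)
  calc _ ≤ ∫ s in a..t, |k s (r + t - s)| := by
        refine (intervalIntegral.abs_integral_le_integral_abs ht.1).trans_eq ?_
        simp
    _ ≤ _ := intervalIntegral.integral_mono_interval le_rfl ht.1 ht.2
        (Filter.Eventually.of_forall fun s => abs_nonneg _) (hks.intervalIntegrable _ _)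

/-- Energy and maximal-function bounds for compactly supported solutions of the transport
equation `(∂ₜ - ∂ᵣ) p = -k`. -/
theorem transport_estimate (hT : a ≤ T) (hR : 0 ≤ R) (hpS : Smooth₂ p)
    (hkc : Continuous fun z : ℝ × ℝ => k z.1 z.2)
    (hp : ∀ t ∈ Set.Icc a T, VanishesOff R (p t)) (hk : ∀ t ∈ Set.Icc a T, VanishesOff R (k t))
    (heq : ∀ t ∈ Set.Icc a T, ∀ r, dt p t r - dr p t r = -k t r) :
    (∀ t ∈ Set.Icc a T, n2 (p t) ≤ n2 (p a) + ∫ s in a..T, n2 (k s)) ∧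
    ∃ m : ℝ → ℝ, (∀ t, 0 ≤ m t) ∧ MemLp m 2 ∧
      ∫ t, m t ^ 2 ≤ 20 * (n2 (p a) + ∫ s in a..T, n2 (k s)) ^ 2 ∧
      ∀ t ∈ Set.Icc a T, ∀ r, avg (fun x => |p t x|) 0 r ≤ m t := by
  set G := envelope p k a T with hGdef
  have hGc : Continuous G := continuous_envelope hpS.continuous hkc
  have hG0 : ∀ y, 0 ≤ G y := envelope_nonneg hT
  have hGM := vanishesOff_envelope hT hp hk
  have hGn : n2 G ≤ _ := n2_envelope_le hT hR hpS.continuous hkc hp hk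
  have hpG : ∀ t ∈ Set.Icc a T, ∀ r, |p t r| ≤ G (r + t) := fun t ht r =>
    abs_le_envelope hpS hkc heq ht r
  have hpt : ∀ t, Continuous (p t) := fun t => hpS.continuous.comp (Continuous.prodMk_right t)
  obtain ⟨b, hb⟩ := hGM.exists_bound hGc
  refine ⟨fun t ht => le_trans ?_ hGn, maxFn G, maxFn_nonneg hG0, ?_⟩
  · have : n2 G = n2 (fun r => G (r + t)) := by
      unfold n2
      rw [integral_add_right_eq_self (fun x => G x ^ 2) t]
    rw [this]
    refine Real.sqrt_le_sqrt (integral_mono ?_ ?_ fun r => ?_)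
    · exact (hp t ht).sq.integrable ((hpt t).pow 2)
    · exact (hGM.sq.integrable (hGc.pow 2)).comp_add_right t
    · exact sq_le_sq.2 ((hpG t ht r).trans (le_abs_self _))
  have hle := lintegral_maxFn_sq_le hGc hG0 hb
  have hG2 : ∫⁻ x, ENNReal.ofReal (G x ^ 2) = ENNReal.ofReal (n2 G ^ 2) := by
    rw [n2_sq, ofReal_integral_eq_lintegral_ofReal (hGM.sq.integrable (hGc.pow 2))
      (Filter.Eventually.of_forall fun _ => sq_nonneg _)]
  rw [hG2] at hle
  have hmeas := measurable_maxFn hGc hb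
  have hint : Integrable fun t => maxFn G t ^ 2 := by
    refine ⟨(hmeas.pow_const 2).aestronglyMeasurable, ?_⟩
    rw [hasFiniteIntegral_iff_ofReal (Filter.Eventually.of_forall fun _ => sq_nonneg _)]
    exact hle.trans_lt (ENNReal.mul_lt_top (by norm_num) ENNReal.ofReal_lt_top)
  refine ⟨(memLp_two_iff_integrable_sq hmeas.aestronglyMeasurable).2 hint, ?_, ?_⟩
  · refine le_trans ?_ (mul_le_mul_of_nonneg_left (pow_le_pow_left₀ (n2_nonneg G) hGn 2)
      (by norm_num : (0:ℝ) ≤ 20))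
    rw [integral_eq_lintegral_of_nonneg_ae (Filter.Eventually.of_forall fun _ => sq_nonneg _)
      hint.aestronglyMeasurable]
    refine ENNReal.toReal_le_of_le_ofReal (by positivity) (hle.trans_eq ?_)
    rw [ENNReal.ofReal_mul (by norm_num)]
    norm_num
  · intro t ht r
    refine le_trans ?_ (avg_le_maxFn hGc hb t r)
    unfold avg
    refine mul_le_mul_of_nonneg_left ?_ (by norm_num)
    refine intervalIntegral.integral_mono_on (by norm_num) ?_ ?_ ?_
    · exact Continuous.intervalIntegrable (((hpt t).comp (by fun_prop)).abs) _ _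
    · exact Continuous.intervalIntegrable (by fun_prop) _ _
    · intro σ _
      refine (hpG t ht _).trans_eq ?_
      congr 1; ring

end Transport

theorem VanishesOff.mono {R R' : ℝ} {g : ℝ → ℝ} (h : VanishesOff R g) (hR : R ≤ R') :
    VanishesOff R' g := fun x hx => h x (hR.trans hx)

theorem VanishesOff.deriv {R R' : ℝ} {g : ℝ → ℝ} (h : VanishesOff R g) (hR : R < R') :
    VanishesOff R' (deriv g) := fun x hx => by
  have : g =ᶠ[nhds x] fun _ => 0 := by
    filter_upwards [(isOpen_lt continuous_const continuous_abs).mem_nhds (hR.trans_le hx)]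
      with y hy using h y (le_of_lt hy)
  rw [this.deriv_eq]
  simp

/-- Two functions of time agreeing on a nondegenerate compact interval have the same derivative at
each of its points, endpoints included. -/
theorem deriv_eq_of_eqOn_Icc {a b t : ℝ} {f g : ℝ → ℝ} (hab : a < b) (ht : t ∈ Set.Icc a b)
    (hf : DifferentiableAt ℝ f t) (hg : DifferentiableAt ℝ g t) (h : Set.EqOn f g (Set.Icc a b)) :
    deriv f t = deriv g t := by
  have hu : UniqueDiffWithinAt ℝ (Set.Icc a b) t := uniqueDiffOn_Icc hab t ht
  rw [← hf.derivWithin hu, ← hg.derivWithin hu]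
  exact derivWithin_congr h (h ht)

/-- Integration by parts identity behind Hardy's inequality. -/
theorem integral_add_mul_deriv_sq {g g' : ℝ → ℝ} {c d : ℝ} (hg : ∀ x, HasDerivAt g (g' x) x)
    (hg' : Continuous g') (hc : c * g c ^ 2 = 0) (hd : d * g d ^ 2 = 0) :
    ∫ x in c..d, (g x + x * g' x) ^ 2 = ∫ x in c..d, (x * g' x) ^ 2 := by
  have hgc : Continuous g := continuous_iff_continuousAt.2 fun x => (hg x).continuousAt
  have h1 : ∀ x ∈ Set.uIcc c d, HasDerivAt (fun x => x * g x ^ 2)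
      ((g x + x * g' x) ^ 2 - (x * g' x) ^ 2) x := by
    intro x _
    refine ((hasDerivAt_id' x).fun_mul ((hg x).fun_pow 2)).congr_deriv ?_
    push_cast
    ring
  have h2 := intervalIntegral.integral_eq_sub_of_hasDerivAt h1
    (Continuous.intervalIntegrable (by fun_prop) _ _)
  rw [intervalIntegral.integral_sub (Continuous.intervalIntegrable (by fun_prop) _ _)
    (Continuous.intervalIntegrable (by fun_prop) _ _), hc, hd] at h2
  linarith

theorem integral_symm_eq {g : ℝ → ℝ} (hg : Continuous g) (R : ℝ) :
    ∫ x in (-R)..R, g x = ∫ x in (0 : ℝ)..R, (g x + g (-x)) := by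
  rw [intervalIntegral.integral_add (hg.intervalIntegrable _ _)
    (Continuous.intervalIntegrable (by fun_prop) _ _),
    intervalIntegral.integral_comp_neg (fun x => g x), neg_zero, add_comm]
  exact (intervalIntegral.integral_add_adjacent_intervals (hg.intervalIntegrable _ _)
    (hg.intervalIntegrable _ _)).symm

theorem n2_le_mul_n2 {R c : ℝ} {g k : ℝ → ℝ} (hc : 0 ≤ c) (hg : Continuous g)
    (hgR : VanishesOff R g) (hk : Continuous k) (hkR : VanishesOff R k)
    (h : ∀ x, |g x| ≤ c * |k x|) : n2 g ≤ c * n2 k := by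
  refine Real.sqrt_le_iff.2 ⟨mul_nonneg hc (n2_nonneg k), ?_⟩
  rw [mul_pow, n2_sq, ← integral_const_mul]
  refine integral_mono (hgR.sq.integrable (hg.pow 2))
    ((hkR.sq.integrable (hk.pow 2)).const_mul _) fun x => ?_
  have := pow_le_pow_left₀ (abs_nonneg _) (h x) 2
  rwa [mul_pow, sq_abs, sq_abs] at this

/-- The one-dimensional Sobolev inequality. -/
theorem sq_le_n2_sq_add {R : ℝ} {g g' : ℝ → ℝ} (hg : ∀ x, HasDerivAt g (g' x) x)
    (hg' : Continuous g') (hgR : VanishesOff R g) (hgR' : VanishesOff R g') (x : ℝ) :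
    g x ^ 2 ≤ n2 g ^ 2 + n2 g' ^ 2 := by
  have hgc : Continuous g := continuous_iff_continuousAt.2 fun x => (hg x).continuousAt
  have hi : Integrable fun y => g y ^ 2 + g' y ^ 2 :=
    (hgR.sq.integrable (hgc.pow 2)).add (hgR'.sq.integrable (hg'.pow 2))
  set c := -|R| - |x|
  have hcx : c ≤ x := by
    have := neg_abs_le x
    have := abs_nonneg R
    simp only [c]
    linarith
  have hc : g c = 0 := by
    refine hgR c ?_
    have h1 : |c| = |R| + |x| := by
      rw [abs_of_nonpos (by simp only [c]; linarith [abs_nonneg R, abs_nonneg x])]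
      simp only [c]; ring
    rw [h1]
    linarith [le_abs_self R, abs_nonneg x]
  have h1 : ∀ y ∈ Set.uIcc c x, HasDerivAt (fun y => g y ^ 2) (2 * g y * g' y) y := by
    intro y _
    simpa using (hg y).fun_pow 2
  have h2 := intervalIntegral.integral_eq_sub_of_hasDerivAt h1
    (Continuous.intervalIntegrable (by fun_prop) _ _)
  rw [hc] at h2
  calc g x ^ 2 = ∫ y in c..x, 2 * g y * g' y := by rw [h2]; ring
    _ ≤ ∫ y in c..x, (g y ^ 2 + g' y ^ 2) :=
        intervalIntegral.integral_mono_on hcx (Continuous.intervalIntegrable (by fun_prop) _ _)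
          (Continuous.intervalIntegrable (by fun_prop) _ _) fun y _ => two_mul_le_add_sq _ _
    _ ≤ ∫ y, (g y ^ 2 + g' y ^ 2) := by
        rw [intervalIntegral.integral_of_le hcx]
        exact setIntegral_le_integral hi (Filter.Eventually.of_forall fun y => by positivity)
    _ = _ := by
        rw [integral_add (hgR.sq.integrable (hgc.pow 2)) (hgR'.sq.integrable (hg'.pow 2)),
          n2_sq, n2_sq]

/-- A spherically symmetric solution of the nonlinear wave equation on `[a, b]`, as a function
`φ t r` of time and signed radius, supported in `|r| < R`. -/
structure RadialWave (a b R : ℝ) (φ : ℝ → ℝ → ℝ) : Prop where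
  lt : a < b
  smooth : Smooth₂ φ
  even : ∀ t ∈ Set.Icc a b, ∀ r, φ t (-r) = φ t r
  vanishes : ∀ t ∈ Set.Icc a b, VanishesOff R (φ t)
  eqn : ∀ t ∈ Set.Icc a b, ∀ r,
    r * dt (dt φ) t r = r * dr (dr φ) t r + 2 * dr φ t r - r * nonlin (φ t r)

/-- The derivative `(∂ₜ + ∂ᵣ)(r φ)` along outgoing characteristics. -/
def outgoing (φ : ℝ → ℝ → ℝ) (t r : ℝ) : ℝ := r * dt φ t r + (φ t r + r * dr φ t r)

theorem Smooth₂.outgoing {φ : ℝ → ℝ → ℝ} (h : Smooth₂ φ) : Smooth₂ (outgoing φ) :=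
  (Smooth₂.snd.mul h.dt).add (h.add (Smooth₂.snd.mul h.dr))

theorem Smooth₂.dr_outgoing {φ : ℝ → ℝ → ℝ} (h : Smooth₂ φ) (t r : ℝ) :
    _root_.dr (_root_.outgoing φ) t r
      = (_root_.dt φ t r + r * _root_.dr (_root_.dt φ) t r)
        + (2 * _root_.dr φ t r + r * _root_.dr (_root_.dr φ) t r) := by
  refine HasDerivAt.deriv (f := _root_.outgoing φ t) ?_
  convert ((hasDerivAt_id' r).fun_mul (h.dt.hasDerivAt_dr t r)).fun_add
    ((h.hasDerivAt_dr t r).fun_add ((hasDerivAt_id' r).fun_mul (h.dr.hasDerivAt_dr t r))) using 1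
  · rfl
  · ring

theorem Smooth₂.dt_outgoing {φ : ℝ → ℝ → ℝ} (h : Smooth₂ φ) (t r : ℝ) :
    _root_.dt (_root_.outgoing φ) t r
      = r * _root_.dt (_root_.dt φ) t r + (_root_.dt φ t r + r * _root_.dr (_root_.dt φ) t r) := by
  refine HasDerivAt.deriv (f := fun s => _root_.outgoing φ s r) ?_
  convert ((h.dt.hasDerivAt_dt t r).const_mul r).fun_add
    ((h.hasDerivAt_dt t r).fun_add ((h.dr.hasDerivAt_dt t r).const_mul r)) using 1
  · rfl
  · rw [h.dt_dr]

namespace RadialWave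

variable {a b R : ℝ} {φ : ℝ → ℝ → ℝ} {t : ℝ}

theorem dt_even (H : RadialWave a b R φ) (ht : t ∈ Set.Icc a b) (r : ℝ) :
    dt φ t (-r) = dt φ t r :=
  deriv_eq_of_eqOn_Icc H.lt ht (H.smooth.hasDerivAt_dt t _).differentiableAt
    (H.smooth.hasDerivAt_dt t _).differentiableAt fun s hs => H.even s hs r

theorem dt_vanishes (H : RadialWave a b R φ) (ht : t ∈ Set.Icc a b) :
    VanishesOff R (dt φ t) := fun r hr => by
  have := deriv_eq_of_eqOn_Icc (g := fun _ => 0) H.lt ht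
    (H.smooth.hasDerivAt_dt t r).differentiableAt
    (differentiableAt_const _) fun s hs => H.vanishes s hs r hr
  simpa [dt] using this

theorem deriv_neg_of_even {g : ℝ → ℝ} (h : ∀ r, g (-r) = g r) (r : ℝ) :
    deriv g (-r) = -deriv g r := by
  have h2 : (fun x => g (-x)) = g := funext h
  have := deriv_comp_neg (f := g) r
  rw [h2] at this
  linarith

theorem dr_odd (H : RadialWave a b R φ) (ht : t ∈ Set.Icc a b) (r : ℝ) :
    dr φ t (-r) = -dr φ t r := deriv_neg_of_even (H.even t ht) r

theorem dr_dt_odd (H : RadialWave a b R φ) (ht : t ∈ Set.Icc a b) (r : ℝ) :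
    dr (dt φ) t (-r) = -dr (dt φ) t r := deriv_neg_of_even (H.dt_even ht) r

theorem dr_dr_even (H : RadialWave a b R φ) (ht : t ∈ Set.Icc a b) (r : ℝ) :
    dr (dr φ) t (-r) = dr (dr φ) t r := by
  have h2 : (fun x => dr φ t (-x)) = fun x => -dr φ t x := funext (H.dr_odd ht)
  have := deriv_comp_neg (f := dr φ t) r
  rw [h2, deriv.fun_neg] at this
  unfold dr at this ⊢
  linarith

theorem dr_zero (H : RadialWave a b R φ) (ht : t ∈ Set.Icc a b) : dr φ t 0 = 0 := by
  have := H.dr_odd ht 0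
  rw [neg_zero] at this
  linarith

theorem outgoing_vanishes (H : RadialWave a b R φ) (ht : t ∈ Set.Icc a b) :
    VanishesOff (R + 1) (outgoing φ t) := fun r hr => by
  have h1 : dr φ t r = 0 := (H.vanishes t ht).deriv (lt_add_one R) r hr
  have h2 : R ≤ |r| := by linarith
  simp [outgoing, h1, H.dt_vanishes ht r h2, H.vanishes t ht r h2]

theorem dr_outgoing_vanishes (H : RadialWave a b R φ) (ht : t ∈ Set.Icc a b) :
    VanishesOff (R + 2) (dr (outgoing φ) t) :=
  (H.outgoing_vanishes ht).deriv (by linarith)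

theorem outgoing_neg (H : RadialWave a b R φ) (ht : t ∈ Set.Icc a b) (r : ℝ) :
    outgoing φ t (-r) = -(r * dt φ t r) + (φ t r + r * dr φ t r) := by
  rw [outgoing, H.dt_even ht, H.even t ht, H.dr_odd ht]
  ring

theorem dr_outgoing_neg (H : RadialWave a b R φ) (ht : t ∈ Set.Icc a b) (r : ℝ) :
    dr (outgoing φ) t (-r) = (dt φ t r + r * dr (dt φ) t r)
      - (2 * dr φ t r + r * dr (dr φ) t r) := by
  rw [H.smooth.dr_outgoing, H.dt_even ht, H.dr_odd ht, H.dr_dt_odd ht, H.dr_dr_even ht]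
  ring

theorem eq_avg (H : RadialWave a b R φ) (ht : t ∈ Set.Icc a b) (r : ℝ) :
    φ t r = avg (outgoing φ t) 0 r := by
  have hP : Continuous (outgoing φ t) :=
    H.smooth.outgoing.continuous.comp (Continuous.prodMk_right t)
  rcases eq_or_ne r 0 with rfl | hr
  · simp [avg, outgoing]
    ring
  · have h1 := mul_avg (G := outgoing φ t) 0 r
    have h2 : ∀ x ∈ Set.uIcc 0 r, HasDerivAt (fun x => 2 * (x * φ t x))
        (outgoing φ t x + outgoing φ t (-x)) x := by
      intro x _
      rw [H.outgoing_neg ht]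
      refine (((hasDerivAt_id' x).fun_mul (H.smooth.hasDerivAt_dr t x)).const_mul 2).congr_deriv ?_
      rw [outgoing]
      ring
    rw [zero_sub, zero_add, integral_symm_eq hP,
      intervalIntegral.integral_eq_sub_of_hasDerivAt h2
        (Continuous.intervalIntegrable (by fun_prop) _ _)] at h1
    have h3 : 2 * r * φ t r = 2 * r * avg (outgoing φ t) 0 r := by rw [h1]; ring
    exact mul_left_cancel₀ (by positivity) h3

theorem abs_le_avg (H : RadialWave a b R φ) (ht : t ∈ Set.Icc a b) (r : ℝ) :
    |φ t r| ≤ avg (fun x => |outgoing φ t x|) 0 r := by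
  have hP : Continuous (outgoing φ t) :=
    H.smooth.outgoing.continuous.comp (Continuous.prodMk_right t)
  rw [H.eq_avg ht]
  unfold avg
  rw [abs_mul, abs_of_pos (by norm_num : (0:ℝ) < 1 / 2)]
  exact mul_le_mul_of_nonneg_left (intervalIntegral.abs_integral_le_integral_abs (by norm_num))
    (by norm_num)

theorem abs_dr_le_avg (H : RadialWave a b R φ) (ht : t ∈ Set.Icc a b) (r : ℝ) :
    |dr φ t r| ≤ avg (fun x => |dr (outgoing φ) t x|) 0 r := by
  have hP : Continuous (outgoing φ t) :=
    H.smooth.outgoing.continuous.comp (Continuous.prodMk_right t)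
  have hP' : Continuous (dr (outgoing φ) t) :=
    H.smooth.outgoing.dr.continuous.comp (Continuous.prodMk_right t)
  rcases eq_or_ne r 0 with rfl | hr
  · rw [H.dr_zero ht, abs_zero]
    exact avg_nonneg (fun _ => abs_nonneg _) _ _
  have h2 : ∀ σ ∈ Set.uIcc (-1 : ℝ) 1, HasDerivAt (fun σ => σ * outgoing φ t (r * σ))
      (outgoing φ t (r * σ) + r * (σ * dr (outgoing φ) t (r * σ))) σ := by
    intro σ _
    have h3 : HasDerivAt (fun σ => outgoing φ t (r * σ)) (dr (outgoing φ) t (r * σ) * r) σ :=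
      (H.smooth.outgoing.hasDerivAt_dr t (r * σ)).comp σ
        (by simpa using (hasDerivAt_id σ).const_mul r)
    refine ((hasDerivAt_id' σ).fun_mul h3).congr_deriv ?_
    ring
  have h4 := intervalIntegral.integral_eq_sub_of_hasDerivAt h2
    (Continuous.intervalIntegrable (by fun_prop) _ _)
  rw [intervalIntegral.integral_add (Continuous.intervalIntegrable (by fun_prop) _ _)
    (Continuous.intervalIntegrable (by fun_prop) _ _), intervalIntegral.integral_const_mul] at h4
  have h5 := H.eq_avg ht r
  simp only [avg, zero_add] at h5
  have h6 : outgoing φ t (r * 1) + outgoing φ t (r * -1) = 2 * (φ t r + r * dr φ t r) := by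
    rw [mul_one, mul_neg_one, H.outgoing_neg ht, outgoing]
    ring
  have h7 : r * dr φ t r = r * (1 / 2 * ∫ σ in (-1 : ℝ)..1, σ * dr (outgoing φ) t (r * σ)) := by
    linarith
  rw [mul_left_cancel₀ hr h7]
  unfold avg
  rw [abs_mul, abs_of_pos (by norm_num : (0:ℝ) < 1 / 2)]
  refine mul_le_mul_of_nonneg_left ((intervalIntegral.abs_integral_le_integral_abs
    (by norm_num)).trans ?_) (by norm_num)
  refine intervalIntegral.integral_mono_on (by norm_num)
    (Continuous.intervalIntegrable (by fun_prop) _ _)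
    (Continuous.intervalIntegrable (by fun_prop) _ _) fun σ hσ => ?_
  rw [abs_mul, zero_add]
  exact mul_le_of_le_one_left (abs_nonneg _) (abs_le.2 hσ)

theorem continuous_at (h : Smooth₂ φ) (t : ℝ) : Continuous (φ t) :=
  h.continuous.comp (Continuous.prodMk_right t)

theorem n2_outgoing_sq (H : RadialWave a b R φ) (ht : t ∈ Set.Icc a b) (hR : 0 ≤ R) :
    n2 (outgoing φ t) ^ 2
      = 2 * ∫ r in (0 : ℝ)..(R + 2), ((r * dt φ t r) ^ 2 + (r * dr φ t r) ^ 2) := by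
  have c1 := continuous_at H.smooth.outgoing t
  have c2 := continuous_at H.smooth.dt t
  have c3 := continuous_at H.smooth.dr t
  have c4 := continuous_at H.smooth t
  have hi := integral_add_mul_deriv_sq (c := 0) (d := R + 2) (H.smooth.hasDerivAt_dr t) c3
    (by simp) (by
      rw [H.vanishes t ht (R + 2) (by rw [abs_of_nonneg] <;> linarith)]; simp)
  rw [n2_sq, ((H.outgoing_vanishes ht).mono (by linarith : R + 1 ≤ R + 2)).sq.integral_eq,
    integral_symm_eq (g := fun x => outgoing φ t x ^ 2) (c1.pow 2)]
  calc _ = ∫ r in (0 : ℝ)..(R + 2), (2 * (r * dt φ t r) ^ 2 + 2 * (φ t r + r * dr φ t r) ^ 2) := by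
        refine intervalIntegral.integral_congr fun r _ => ?_
        rw [H.outgoing_neg ht, outgoing]
        ring
    _ = _ := by
        rw [intervalIntegral.integral_add (Continuous.intervalIntegrable (by fun_prop) _ _)
          (Continuous.intervalIntegrable (by fun_prop) _ _),
          intervalIntegral.integral_add (Continuous.intervalIntegrable (by fun_prop) _ _)
          (Continuous.intervalIntegrable (by fun_prop) _ _),
          intervalIntegral.integral_const_mul, intervalIntegral.integral_const_mul, hi]
        ring

theorem n2_dr_outgoing_sq (H : RadialWave a b R φ) (ht : t ∈ Set.Icc a b) (hR : 0 ≤ R) :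
    n2 (dr (outgoing φ) t) ^ 2
      = 2 * ∫ r in (0 : ℝ)..(R + 2), ((r * dr (dt φ) t r) ^ 2 + (r * dr (dr φ) t r) ^ 2
          + 2 * dr φ t r ^ 2) := by
  have c1 := continuous_at H.smooth.outgoing.dr t
  have c2 := continuous_at H.smooth.dt t
  have c3 := continuous_at H.smooth.dr t
  have c4 := continuous_at H.smooth.dt.dr t
  have c5 := continuous_at H.smooth.dr.dr t
  have habs : |R + 2| = R + 2 := abs_of_nonneg (by linarith)
  have hi := integral_add_mul_deriv_sq (c := 0) (d := R + 2) (H.smooth.dt.hasDerivAt_dr t) c4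
    (by simp) (by rw [H.dt_vanishes ht (R + 2) (by rw [habs]; linarith)]; simp)
  have hz : dr φ t (R + 2) = 0 :=
    (H.vanishes t ht).deriv (by linarith : R < R + 2) _ habs.ge
  have hj := integral_add_mul_deriv_sq (c := 0) (d := R + 2) (H.smooth.dr.hasDerivAt_dr t) c5
    (by simp) (by rw [hz]; simp)
  have hj' : ∫ r in (0 : ℝ)..(R + 2), (2 * dr φ t r + r * dr (dr φ) t r) ^ 2
      = (∫ r in (0 : ℝ)..(R + 2), (r * dr (dr φ) t r) ^ 2)
        + 2 * ∫ r in (0 : ℝ)..(R + 2), dr φ t r ^ 2 := by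
    have e1 : ∫ r in (0 : ℝ)..(R + 2), (2 * dr φ t r + r * dr (dr φ) t r) ^ 2
        = ∫ r in (0 : ℝ)..(R + 2), (2 * (dr φ t r + r * dr (dr φ) t r) ^ 2
          - (r * dr (dr φ) t r) ^ 2 + 2 * dr φ t r ^ 2) :=
      intervalIntegral.integral_congr fun r _ => by ring
    rw [e1, intervalIntegral.integral_add (Continuous.intervalIntegrable (by fun_prop) _ _)
          (Continuous.intervalIntegrable (by fun_prop) _ _),
        intervalIntegral.integral_sub (Continuous.intervalIntegrable (by fun_prop) _ _)
          (Continuous.intervalIntegrable (by fun_prop) _ _),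
        intervalIntegral.integral_const_mul, intervalIntegral.integral_const_mul, hj]
    ring
  rw [n2_sq, (H.dr_outgoing_vanishes ht).sq.integral_eq,
    integral_symm_eq (g := fun x => dr (outgoing φ) t x ^ 2) (c1.pow 2)]
  calc _ = ∫ r in (0 : ℝ)..(R + 2), (2 * (dt φ t r + r * dr (dt φ) t r) ^ 2
          + 2 * (2 * dr φ t r + r * dr (dr φ) t r) ^ 2) := by
        refine intervalIntegral.integral_congr fun r _ => ?_
        rw [H.dr_outgoing_neg ht, H.smooth.dr_outgoing]
        ring
    _ = _ := by
        rw [intervalIntegral.integral_add (Continuous.intervalIntegrable (by fun_prop) _ _)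
          (Continuous.intervalIntegrable (by fun_prop) _ _),
          intervalIntegral.integral_add (Continuous.intervalIntegrable (by fun_prop) _ _)
          (Continuous.intervalIntegrable (by fun_prop) _ _),
          intervalIntegral.integral_add (Continuous.intervalIntegrable (by fun_prop) _ _)
          (Continuous.intervalIntegrable (by fun_prop) _ _),
          intervalIntegral.integral_const_mul, intervalIntegral.integral_const_mul,
          intervalIntegral.integral_const_mul, hi, hj']
        ring

end RadialWave

theorem contDiff_nonlin : ContDiff ℝ (⊤ : ℕ∞) nonlin := by
  unfold nonlin
  exact (contDiff_id.pow 5).mul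
    ((contDiff_const.add (contDiff_id.pow 2)).log fun x => by positivity)

theorem log_two_add_sq_nonneg (u : ℝ) : 0 ≤ log (2 + u ^ 2) :=
  log_nonneg (by nlinarith [sq_nonneg u])

theorem hasDerivAt_nonlin (u : ℝ) :
    HasDerivAt nonlin (5 * u ^ 4 * log (2 + u ^ 2) + u ^ 5 * (2 * u / (2 + u ^ 2))) u := by
  have h1 : HasDerivAt (fun u : ℝ => log (2 + u ^ 2)) (2 * u / (2 + u ^ 2)) u := by
    refine HasDerivAt.log ?_ (by positivity)
    simpa using ((hasDerivAt_id' u).fun_pow 2).const_add 2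
  refine (((hasDerivAt_id' u).fun_pow 5).fun_mul h1).congr_deriv ?_
  push_cast
  ring

theorem abs_deriv_nonlin_le (u : ℝ) : |deriv nonlin u| ≤ 8 * (u ^ 4 * log (2 + u ^ 2)) := by
  have h2 : (2 : ℝ) / 3 ≤ log (2 + u ^ 2) := by
    refine le_trans ?_ (log_le_log two_pos (le_add_of_nonneg_right (sq_nonneg u)))
    linarith [log_two_gt_d9]
  have h3 : u ^ 5 * (2 * u / (2 + u ^ 2)) = u ^ 4 * (2 * (u ^ 2 / (2 + u ^ 2))) := by ring
  have h4 : u ^ 2 / (2 + u ^ 2) ≤ 1 := by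
    rw [div_le_one (by positivity)]
    linarith
  have h5 : u ^ 4 * (2 * (u ^ 2 / (2 + u ^ 2))) ≤ u ^ 4 * (3 * log (2 + u ^ 2)) :=
    mul_le_mul_of_nonneg_left (by linarith) (by positivity)
  have h6 : 0 ≤ 5 * u ^ 4 * log (2 + u ^ 2) :=
    mul_nonneg (by positivity) (log_two_add_sq_nonneg u)
  rw [(hasDerivAt_nonlin u).deriv, h3, abs_of_nonneg (add_nonneg h6 (by positivity))]
  linarith

/-- The nonlinearity in the equation satisfied by `r φ`. -/
def source (φ : ℝ → ℝ → ℝ) (t r : ℝ) : ℝ := r * nonlin (φ t r)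

/-- The potential `r φ⁴ log (2 + φ²)`. -/
def potential (φ : ℝ → ℝ → ℝ) (t r : ℝ) : ℝ := r * (φ t r ^ 4 * log (2 + φ t r ^ 2))

/-- The radial density of the quantity `A`. -/
def density (φ : ℝ → ℝ → ℝ) (t : ℝ) : ℝ := ∫ r, r ^ 2 * (|φ t r| ^ 8 * log (2 + φ t r ^ 2))

theorem Smooth₂.source {φ : ℝ → ℝ → ℝ} (h : Smooth₂ φ) : Smooth₂ (source φ) :=
  Smooth₂.snd.mul (Smooth₂.comp_left contDiff_nonlin h)

theorem Smooth₂.dr_source {φ : ℝ → ℝ → ℝ} (h : Smooth₂ φ) (t r : ℝ) :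
    _root_.dr (_root_.source φ) t r
      = nonlin (φ t r) + r * (deriv nonlin (φ t r) * _root_.dr φ t r) := by
  refine HasDerivAt.deriv (f := _root_.source φ t) ?_
  refine ((hasDerivAt_id' r).fun_mul
    ((hasDerivAt_nonlin (φ t r)).comp r (h.hasDerivAt_dr t r))).congr_deriv ?_
  rw [(hasDerivAt_nonlin (φ t r)).deriv]
  simp

theorem continuous_log_two_add_sq : Continuous fun u : ℝ => log (2 + u ^ 2) :=
  Continuous.log (by fun_prop) fun u => by positivity

theorem Smooth₂.continuous_potential {φ : ℝ → ℝ → ℝ} (h : Smooth₂ φ) :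
    Continuous fun z : ℝ × ℝ => potential φ z.1 z.2 :=
  continuous_snd.mul ((h.continuous.pow 4).mul (continuous_log_two_add_sq.comp h.continuous))

theorem Smooth₂.continuous_density {φ : ℝ → ℝ → ℝ} (h : Smooth₂ φ) :
    Continuous fun z : ℝ × ℝ => z.2 ^ 2 * (|φ z.1 z.2| ^ 8 * log (2 + φ z.1 z.2 ^ 2)) :=
  (continuous_snd.pow 2).mul
    ((h.continuous.abs.pow 8).mul (continuous_log_two_add_sq.comp h.continuous))

theorem density_nonneg (φ : ℝ → ℝ → ℝ) (t : ℝ) : 0 ≤ density φ t :=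
  integral_nonneg fun r => mul_nonneg (sq_nonneg _)
    (mul_nonneg (by positivity) (log_two_add_sq_nonneg _))

namespace RadialWave

variable {a b R : ℝ} {φ : ℝ → ℝ → ℝ} {t : ℝ}

theorem transport_outgoing (H : RadialWave a b R φ) (ht : t ∈ Set.Icc a b) (r : ℝ) :
    dt (outgoing φ) t r - dr (outgoing φ) t r = -source φ t r := by
  rw [H.smooth.dt_outgoing, H.smooth.dr_outgoing, source, H.eqn t ht]
  ring

theorem transport_dr_outgoing (H : RadialWave a b R φ) (ht : t ∈ Set.Icc a b) (r : ℝ) :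
    dt (dr (outgoing φ)) t r - dr (dr (outgoing φ)) t r = -dr (source φ) t r := by
  have hP := H.smooth.outgoing
  have h1 : (fun r => dt (outgoing φ) t r - dr (outgoing φ) t r) = fun r => -source φ t r :=
    funext (H.transport_outgoing ht)
  have h2 := (hP.dt.hasDerivAt_dr t r).fun_sub (hP.dr.hasDerivAt_dr t r)
  rw [hP.dt_dr, ← h2.deriv, h1]
  exact (H.smooth.source.hasDerivAt_dr t r).fun_neg.deriv

theorem source_vanishes (H : RadialWave a b R φ) (ht : t ∈ Set.Icc a b) :
    VanishesOff R (source φ t) := fun r hr => by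
  simp [source, nonlin, H.vanishes t ht r hr]

theorem potential_vanishes (H : RadialWave a b R φ) (ht : t ∈ Set.Icc a b) :
    VanishesOff R (potential φ t) := fun r hr => by
  simp [potential, H.vanishes t ht r hr]

theorem n2_source_le (H : RadialWave a b R φ) (ht : t ∈ Set.Icc a b) {X : ℝ}
    (hX : ∀ r, |φ t r| ≤ X) : n2 (source φ t) ≤ X * n2 (potential φ t) := by
  refine n2_le_mul_n2 ((abs_nonneg _).trans (hX 0)) (continuous_at H.smooth.source t)
    (H.source_vanishes ht) (H.smooth.continuous_potential.comp (Continuous.prodMk_right t))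
    (H.potential_vanishes ht) fun r => ?_
  have : source φ t r = φ t r * potential φ t r := by
    rw [source, potential, nonlin]
    ring
  rw [this, abs_mul]
  exact mul_le_mul_of_nonneg_right (hX r) (abs_nonneg _)

theorem n2_dr_source_le (H : RadialWave a b R φ) (ht : t ∈ Set.Icc a b) {Y : ℝ} (hR : 0 ≤ R)
    (hY : ∀ r, |dr φ t r| ≤ Y) : n2 (dr (source φ) t) ≤ 8 * Y * n2 (potential φ t) := by
  have hv : VanishesOff (R + 1) (dr φ t) := (H.vanishes t ht).deriv (lt_add_one R)
  have hsv : VanishesOff (R + 1) (dr (source φ) t) := (H.source_vanishes ht).deriv (lt_add_one R)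
  have hc : Continuous fun r => deriv nonlin (φ t r) * dr φ t r :=
    ((contDiff_nonlin.continuous_deriv (by simp)).comp (continuous_at H.smooth t)).mul
      (continuous_at H.smooth.dr t)
  have hd : ∀ r, HasDerivAt (fun r => nonlin (φ t r)) (deriv nonlin (φ t r) * dr φ t r) r :=
    fun r => by
      rw [(hasDerivAt_nonlin (φ t r)).deriv]
      exact (hasDerivAt_nonlin (φ t r)).comp r (H.smooth.hasDerivAt_dr t r)
  have habs : |R + 1| = R + 1 := abs_of_nonneg (by linarith)
  have hz : ∀ c, |c| = R + 1 → c * nonlin (φ t c) ^ 2 = 0 := fun c hc => by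
    rw [H.vanishes t ht c (by linarith)]
    simp [nonlin]
  have h1 := integral_add_mul_deriv_sq hd hc (hz (-(R + 1)) (by rw [abs_neg, habs]))
    (hz (R + 1) habs)
  have h2 : n2 (dr (source φ) t) = n2 fun r => r * (deriv nonlin (φ t r) * dr φ t r) := by
    unfold n2
    rw [hsv.sq.integral_eq, (VanishesOff.mul_left (VanishesOff.mul_left hv)).sq.integral_eq, ← h1]
    simp only [H.smooth.dr_source]
  rw [h2]
  refine n2_le_mul_n2 (by linarith [(abs_nonneg _).trans (hY 0)]) (continuous_id.mul hc)
    (VanishesOff.mul_left (VanishesOff.mul_left hv))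
    (H.smooth.continuous_potential.comp (Continuous.prodMk_right t))
    ((H.potential_vanishes ht).mono (by linarith)) fun r => ?_
  have h3 := abs_deriv_nonlin_le (φ t r)
  have h4 : 0 ≤ φ t r ^ 4 * log (2 + φ t r ^ 2) :=
    mul_nonneg (by positivity) (log_two_add_sq_nonneg _)
  rw [potential, abs_mul, abs_mul, abs_mul, abs_of_nonneg h4]
  calc |r| * (|deriv nonlin (φ t r)| * |dr φ t r|)
      ≤ |r| * (8 * (φ t r ^ 4 * log (2 + φ t r ^ 2)) * Y) := by
        gcongr
        exact hY r
    _ = _ := by ring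

theorem n2_potential_sq_le (H : RadialWave a b R φ) (ht : t ∈ Set.Icc a b) {L : ℝ}
    (hL : ∀ r, log (2 + φ t r ^ 2) ≤ L) : n2 (potential φ t) ^ 2 ≤ L * density φ t := by
  rw [n2_sq, density, ← integral_const_mul]
  have hv : VanishesOff R fun r => r ^ 2 * (|φ t r| ^ 8 * log (2 + φ t r ^ 2)) := fun r hr => by
    simp [H.vanishes t ht r hr]
  refine integral_mono ((H.potential_vanishes ht).sq.integrable
    ((H.smooth.continuous_potential.comp (Continuous.prodMk_right t)).pow 2))
    ((hv.integrable (H.smooth.continuous_density.comp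
      (Continuous.prodMk_right t))).const_mul _) fun r => ?_
  have h1 : |φ t r| ^ 8 = φ t r ^ 8 := (by decide : Even 8).pow_abs _
  have h2 : 0 ≤ r ^ 2 * (φ t r ^ 8 * log (2 + φ t r ^ 2)) :=
    mul_nonneg (sq_nonneg _) (mul_nonneg (by positivity) (log_two_add_sq_nonneg _))
  calc potential φ t r ^ 2
      = log (2 + φ t r ^ 2) * (r ^ 2 * (φ t r ^ 8 * log (2 + φ t r ^ 2))) := by
        rw [potential]; ring
    _ ≤ L * (r ^ 2 * (|φ t r| ^ 8 * log (2 + φ t r ^ 2))) := by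
        rw [h1]
        exact mul_le_mul_of_nonneg_right (hL r) h2

theorem continuousOn_density (H : RadialWave a b R φ) :
    ContinuousOn (density φ) (Set.Icc a b) := by
  have h : ∀ t ∈ Set.Icc a b, density φ t
      = ∫ r in (-R)..R, r ^ 2 * (|φ t r| ^ 8 * log (2 + φ t r ^ 2)) := fun t ht =>
    VanishesOff.integral_eq fun r hr => by simp [H.vanishes t ht r hr]
  refine ContinuousOn.congr (Continuous.continuousOn ?_) h
  exact intervalIntegral.continuous_parametric_intervalIntegral_of_continuous'
    H.smooth.continuous_density _ _

theorem continuousOn_n2_potential (H : RadialWave a b R φ) :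
    ContinuousOn (fun t => n2 (potential φ t)) (Set.Icc a b) :=
  continuousOn_n2 H.smooth.continuous_potential fun _ ht => H.potential_vanishes ht

theorem continuousOn_n2_source (H : RadialWave a b R φ) :
    ContinuousOn (fun t => n2 (source φ t)) (Set.Icc a b) :=
  continuousOn_n2 H.smooth.source.continuous fun _ ht => H.source_vanishes ht

theorem continuousOn_n2_dr_source (H : RadialWave a b R φ) :
    ContinuousOn (fun t => n2 (dr (source φ) t)) (Set.Icc a b) :=
  continuousOn_n2 H.smooth.source.dr.continuous fun _ ht =>
    (H.source_vanishes ht).deriv (lt_add_one R)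

/-- The square root of the higher energy at the initial time. -/
def initial (φ : ℝ → ℝ → ℝ) (a : ℝ) : ℝ := n2 (outgoing φ a) + n2 (dr (outgoing φ) a)

/-- The quantity controlling the solution on `[a, T]` in the bootstrap argument. -/
def control (φ : ℝ → ℝ → ℝ) (a T : ℝ) : ℝ :=
  initial φ a + ∫ s in a..T, (n2 (source φ s) + n2 (dr (source φ) s))

theorem initial_nonneg (φ : ℝ → ℝ → ℝ) (a : ℝ) : 0 ≤ initial φ a :=
  add_nonneg (n2_nonneg _) (n2_nonneg _)

end RadialWave

namespace RadialWave

variable {a b R T : ℝ} {φ : ℝ → ℝ → ℝ} {t : ℝ}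

theorem control_eq (H : RadialWave a b R φ) (hT : T ∈ Set.Icc a b) :
    control φ a T = (n2 (outgoing φ a) + ∫ s in a..T, n2 (source φ s))
      + (n2 (dr (outgoing φ) a) + ∫ s in a..T, n2 (dr (source φ) s)) := by
  have hsub : Set.uIcc a T ⊆ Set.Icc a b := by
    rw [Set.uIcc_of_le hT.1]
    exact Set.Icc_subset_Icc_right hT.2
  rw [control, initial, intervalIntegral.integral_add
    (H.continuousOn_n2_source.mono hsub).intervalIntegrable
    (H.continuousOn_n2_dr_source.mono hsub).intervalIntegrable]
  ring

/-- Energy, pointwise and Strichartz type bounds in terms of `control`. -/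
theorem estimates (H : RadialWave a b R φ) (hR : 0 ≤ R) (hT : T ∈ Set.Icc a b) :
    (∀ t ∈ Set.Icc a T, n2 (outgoing φ t) ≤ control φ a T ∧
      n2 (dr (outgoing φ) t) ≤ control φ a T ∧ ∀ r, φ t r ^ 2 ≤ control φ a T ^ 2) ∧
    ∃ m₀ m₁ : ℝ → ℝ, (∀ t, 0 ≤ m₀ t) ∧ MemLp m₀ 2 ∧ ∫ t, m₀ t ^ 2 ≤ 20 * control φ a T ^ 2 ∧
      (∀ t, 0 ≤ m₁ t) ∧ MemLp m₁ 2 ∧ ∫ t, m₁ t ^ 2 ≤ 20 * control φ a T ^ 2 ∧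
      ∀ t ∈ Set.Icc a T, ∀ r, |φ t r| ≤ m₀ t ∧ |dr φ t r| ≤ m₁ t := by
  have hsub : ∀ {t}, t ∈ Set.Icc a T → t ∈ Set.Icc a b := fun h => ⟨h.1, h.2.trans hT.2⟩
  obtain ⟨e0, m₀, hm0, hm0L, hm0i, hm0b⟩ := transport_estimate hT.1 (by linarith : 0 ≤ R + 2)
    H.smooth.outgoing H.smooth.source.continuous
    (fun t ht => (H.outgoing_vanishes (hsub ht)).mono (by linarith))
    (fun t ht => (H.source_vanishes (hsub ht)).mono (by linarith))
    fun t ht r => H.transport_outgoing (hsub ht) r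
  obtain ⟨e1, m₁, hm1, hm1L, hm1i, hm1b⟩ := transport_estimate hT.1 (by linarith : 0 ≤ R + 2)
    H.smooth.outgoing.dr H.smooth.source.dr.continuous
    (fun t ht => H.dr_outgoing_vanishes (hsub ht))
    (fun t ht => (H.source_vanishes (hsub ht)).deriv (by linarith))
    fun t ht r => H.transport_dr_outgoing (hsub ht) r
  have hK := H.control_eq hT
  set k₀ := n2 (outgoing φ a) + ∫ s in a..T, n2 (source φ s)
  set k₁ := n2 (dr (outgoing φ) a) + ∫ s in a..T, n2 (dr (source φ) s)
  have hk0 : 0 ≤ k₀ := add_nonneg (n2_nonneg _)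
    (intervalIntegral.integral_nonneg hT.1 fun _ _ => n2_nonneg _)
  have hk1 : 0 ≤ k₁ := add_nonneg (n2_nonneg _)
    (intervalIntegral.integral_nonneg hT.1 fun _ _ => n2_nonneg _)
  have s0 : k₀ ^ 2 ≤ (k₀ + k₁) ^ 2 := pow_le_pow_left₀ hk0 (by linarith) 2
  have s1 : k₁ ^ 2 ≤ (k₀ + k₁) ^ 2 := pow_le_pow_left₀ hk1 (by linarith) 2
  rw [hK]
  refine ⟨fun t ht => ⟨(e0 t ht).trans (by linarith), (e1 t ht).trans (by linarith), fun r => ?_⟩,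
    m₀, m₁, hm0, hm0L, hm0i.trans (by linarith), hm1, hm1L, hm1i.trans (by linarith),
    fun t ht r => ⟨(H.abs_le_avg (hsub ht) r).trans (hm0b t ht r),
      (H.abs_dr_le_avg (hsub ht) r).trans (hm1b t ht r)⟩⟩
  have hb : ∀ x, |outgoing φ t x| ≤ k₀ + k₁ := fun x => by
    refine abs_le_of_sq_le_sq ?_ (by positivity)
    have h1 := sq_le_n2_sq_add (H.smooth.outgoing.hasDerivAt_dr t)
      (continuous_at H.smooth.outgoing.dr t)
      ((H.outgoing_vanishes (hsub ht)).mono (by linarith : R + 1 ≤ R + 2))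
      (H.dr_outgoing_vanishes (hsub ht)) x
    have h2 := pow_le_pow_left₀ (n2_nonneg _) (e0 t ht) 2
    have h3 := pow_le_pow_left₀ (n2_nonneg _) (e1 t ht) 2
    nlinarith [mul_nonneg hk0 hk1]
  have h4 := (H.abs_le_avg (hsub ht) r).trans
    (avg_le (continuous_at H.smooth.outgoing t).abs hb 0 r)
  exact sq_le_sq' (by linarith [neg_abs_le (φ t r)]) ((le_abs_self _).trans h4)

theorem integral_mul_n2_potential_le (H : RadialWave a b R φ) (hT : T ∈ Set.Icc a b) {m g : ℝ → ℝ}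
    {K L c : ℝ} (hK : 0 ≤ K) (hc : 0 ≤ c) (hm0 : ∀ t, 0 ≤ m t) (hm : MemLp m 2)
    (hmi : ∫ t, m t ^ 2 ≤ 20 * K ^ 2) (hL : ∀ t ∈ Set.Icc a T, ∀ r, log (2 + φ t r ^ 2) ≤ L)
    (hg : ContinuousOn g (Set.Icc a T))
    (hgm : ∀ t ∈ Set.Icc a T, g t ≤ c * m t * n2 (potential φ t)) :
    ∫ t in a..T, g t ≤ c * (5 * K * √(L * ∫ t in a..b, density φ t)) := by
  have hsub : Set.Icc a T ⊆ Set.Icc a b := Set.Icc_subset_Icc_right hT.2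
  have hNc := H.continuousOn_n2_potential.mono hsub
  have hL0 : 0 ≤ L := (log_two_add_sq_nonneg _).trans (hL a ⟨le_rfl, hT.1⟩ 0)
  have hN : MemLp (fun t => n2 (potential φ t)) 2 (volume.restrict (Set.Icc a T)) := by
    obtain ⟨B, hB⟩ := isCompact_Icc.exists_bound_of_continuousOn hNc
    refine MemLp.of_bound (hNc.aestronglyMeasurable measurableSet_Icc) B ?_
    exact (ae_restrict_iff' measurableSet_Icc).2 (Filter.Eventually.of_forall hB)
  have hmr : MemLp m 2 (volume.restrict (Set.Icc a T)) := hm.restrict _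
  have hcs := integral_mul_le_sqrt_mul_sqrt hm0 (fun t => n2_nonneg (potential φ t)) hmr hN
  have h1 : ∫ t in Set.Icc a T, m t ^ 2 ≤ 20 * K ^ 2 :=
    (setIntegral_le_integral hm.integrable_sq
      (Filter.Eventually.of_forall fun t => sq_nonneg (m t))).trans hmi
  have hdc := H.continuousOn_density
  have h2 : ∫ t in Set.Icc a T, n2 (potential φ t) ^ 2 ≤ L * ∫ t in a..b, density φ t := by
    rw [intervalIntegral.integral_of_le H.lt.le, ← integral_Icc_eq_integral_Ioc]
    calc _ ≤ ∫ t in Set.Icc a T, L * density φ t :=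
          setIntegral_mono_on (hNc.pow 2).integrableOn_Icc
            ((continuousOn_const.mul (hdc.mono hsub)).integrableOn_Icc) measurableSet_Icc
            fun t ht => H.n2_potential_sq_le (hsub ht) (hL t ht)
      _ = L * ∫ t in Set.Icc a T, density φ t := integral_const_mul _ _
      _ ≤ _ := mul_le_mul_of_nonneg_left (setIntegral_mono_set hdc.integrableOn_Icc
          (Filter.Eventually.of_forall (density_nonneg φ)) hsub.eventuallyLE) hL0
  rw [intervalIntegral.integral_of_le hT.1, ← integral_Icc_eq_integral_Ioc]
  calc ∫ t in Set.Icc a T, g t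
      ≤ ∫ t in Set.Icc a T, c * (m t * n2 (potential φ t)) := by
        refine setIntegral_mono_on hg.integrableOn_Icc ((hmr.integrable_mul hN).const_mul c)
          measurableSet_Icc fun t ht => (hgm t ht).trans_eq (mul_assoc _ _ _)
    _ = c * ∫ t in Set.Icc a T, m t * n2 (potential φ t) := integral_const_mul _ _
    _ ≤ _ := by
        refine mul_le_mul_of_nonneg_left (hcs.trans ?_) hc
        refine mul_le_mul ?_ (Real.sqrt_le_sqrt h2) (Real.sqrt_nonneg _) (by positivity)
        refine Real.sqrt_le_iff.2 ⟨by positivity, h1.trans ?_⟩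
        nlinarith [sq_nonneg K]

theorem control_nonneg (hT : a ≤ T) : 0 ≤ control φ a T :=
  add_nonneg (initial_nonneg _ _) (intervalIntegral.integral_nonneg hT fun _ _ =>
    add_nonneg (n2_nonneg _) (n2_nonneg _))

theorem control_le (H : RadialWave a b R φ) (hR : 0 ≤ R) (hT : T ∈ Set.Icc a b) :
    control φ a T ≤ initial φ a + 45 * control φ a T
      * √(log (2 + control φ a T ^ 2) * ∫ t in a..b, density φ t) := by
  have hsub : Set.Icc a T ⊆ Set.Icc a b := Set.Icc_subset_Icc_right hT.2
  obtain ⟨he, m₀, m₁, hm0, hm0L, hm0i, hm1, hm1L, hm1i, hm⟩ := H.estimates hR hT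
  have hL : ∀ t ∈ Set.Icc a T, ∀ r, log (2 + φ t r ^ 2) ≤ log (2 + control φ a T ^ 2) :=
    fun t ht r => log_le_log (by positivity) (by linarith [(he t ht).2.2 r])
  have h0 := H.integral_mul_n2_potential_le hT (control_nonneg hT.1) zero_le_one hm0 hm0L hm0i hL
    (H.continuousOn_n2_source.mono hsub) fun t ht => by
      rw [one_mul]
      exact H.n2_source_le (hsub ht) fun r => (hm t ht r).1
  have h1 := H.integral_mul_n2_potential_le hT (control_nonneg hT.1) (by norm_num : (0:ℝ) ≤ 8)
    hm1 hm1L hm1i hL (H.continuousOn_n2_dr_source.mono hsub) fun t ht =>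
      H.n2_dr_source_le (hsub ht) hR fun r => (hm t ht r).2
  have h2 := H.control_eq hT
  rw [initial]
  linarith

/-- The continuity argument. -/
theorem control_le_two_mul (H : RadialWave a b R φ) (hR : 0 ≤ R)
    (hA : log (2 + (2 * initial φ a + 1) ^ 2) * ∫ t in a..b, density φ t ≤ 1 / 180 ^ 2) :
    control φ a b ≤ 2 * initial φ a := by
  have hi := initial_nonneg φ a
  have hd : 0 ≤ ∫ t in a..b, density φ t :=
    intervalIntegral.integral_nonneg H.lt.le fun t _ => density_nonneg φ t
  have key : ∀ T ∈ Set.Icc a b, control φ a T ≤ 2 * initial φ a + 1 →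
      control φ a T ≤ 4 / 3 * initial φ a := by
    intro T hT hle
    have h0 : 0 ≤ control φ a T := control_nonneg hT.1
    have h1 : √(log (2 + control φ a T ^ 2) * ∫ t in a..b, density φ t) ≤ 1 / 180 := by
      refine Real.sqrt_le_iff.2 ⟨by norm_num, ?_⟩
      rw [div_pow, one_pow]
      refine le_trans ?_ hA
      refine mul_le_mul_of_nonneg_right (log_le_log (by positivity) ?_) hd
      linarith [pow_le_pow_left₀ h0 hle 2]
    have h2 := H.control_le hR hT
    have h3 := mul_le_mul_of_nonneg_left h1 (by positivity : 0 ≤ 45 * control φ a T)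
    linarith
  have hle : control φ a b ≤ 2 * initial φ a + 1 := by
    by_contra! hlt
    have hc : ContinuousOn (control φ a) (Set.Icc a b) := by
      refine continuousOn_const.add ?_
      have := intervalIntegral.continuousOn_primitive_interval
        (μ := volume) (f := fun s => n2 (source φ s) + n2 (dr (source φ) s)) (a := a) (b := b) (by
          rw [Set.uIcc_of_le H.lt.le]
          exact (H.continuousOn_n2_source.add H.continuousOn_n2_dr_source).integrableOn_Icc)
      rwa [Set.uIcc_of_le H.lt.le] at this
    have ha : control φ a a = initial φ a := by simp [control]
    obtain ⟨T, hT, hTe⟩ := intermediate_value_Icc H.lt.le hc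
      (⟨by rw [ha]; linarith, hlt.le⟩ : 2 * initial φ a + 1 ∈ Set.Icc _ _)
    have := key T hT hTe.le
    linarith
  linarith [key b ⟨H.lt.le, le_rfl⟩ hle]

end RadialWave

theorem abs_le_exp_of_abs_deriv_le {f f' : ℝ → ℝ} {a t C l : ℝ} (hl : 0 < l) (hC : 0 ≤ C)
    (hf : ∀ s, HasDerivAt f (f' s) s) (ha : f a = 0) (hat : a ≤ t)
    (hb : ∀ s ∈ Set.Icc a t, |f' s| ≤ C * exp (l * (s - a))) :
    |f t| ≤ C / l * exp (l * (t - a)) := by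
  have hB : ∀ s, HasDerivAt (fun s => C / l * exp (l * (s - a))) (C * exp (l * (s - a))) s := by
    intro s
    refine ((((hasDerivAt_id' s).sub_const a).const_mul l).exp.const_mul (C / l)).congr_deriv ?_
    field_simp
  have h := image_norm_le_of_norm_deriv_right_le_deriv_boundary (f := f) (f' := f')
    (fun s _ => (hf s).continuousAt.continuousWithinAt)
    (fun s _ => (hf s).hasDerivWithinAt) (B := fun s => C / l * exp (l * (s - a)))
    (by rw [ha, norm_zero]; positivity) hB
    (fun s hs => hb s (Set.Ico_subset_Icc_self hs)) ⟨hat, le_rfl⟩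
  exact h

/-- Finite speed of propagation: a solution of a wave inequality vanishes at the tip of a backward
light triangle on whose base its Cauchy data vanish. -/
theorem Smooth₂.eq_zero_of_cauchyData_eq_zero {w : ℝ → ℝ → ℝ} (hw : Smooth₂ w) {a t r L : ℝ}
    (hat : a ≤ t) (hL : 0 ≤ L)
    (hwave : ∀ s ρ, a ≤ s → |ρ - r| ≤ t - s →
      |_root_.dt (_root_.dt w) s ρ - _root_.dr (_root_.dr w) s ρ| ≤ L * |w s ρ|)
    (h0 : ∀ ρ, |ρ - r| ≤ t - a → w a ρ = 0)
    (h1 : ∀ ρ, |ρ - r| ≤ t - a → _root_.dt w a ρ = 0)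
    (h2 : ∀ ρ, |ρ - r| ≤ t - a → _root_.dr w a ρ = 0) : w t r = 0 := by
  set S : Set (ℝ × ℝ) := {z | a ≤ z.1 ∧ |z.2 - r| ≤ t - z.1} with hS
  have hSc : IsCompact S := by
    refine (isCompact_Icc (a := ((a, r - (t - a)) : ℝ × ℝ))
      (b := (t, r + (t - a)))).of_isClosed_subset ?_ ?_
    · exact (isClosed_le continuous_const continuous_fst).inter
        (isClosed_le (continuous_snd.sub continuous_const).abs
          (continuous_const.sub continuous_fst))
    · rintro ⟨s, ρ⟩ ⟨hs, hρ⟩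
      simp only at hs hρ
      have := abs_nonneg (ρ - r)
      have := abs_le.1 hρ
      exact ⟨⟨hs, by simp only; linarith⟩, ⟨by simp only; linarith, by simp only; linarith⟩⟩
  set l := L + 1 with hl
  have hl0 : 0 < l := by linarith
  have hcont : Continuous fun z : ℝ × ℝ => exp (-(l * (z.1 - a))) * |w z.1 z.2| :=
    (by fun_prop : Continuous fun z : ℝ × ℝ => exp (-(l * (z.1 - a)))).mul hw.continuous.abs
  obtain ⟨z, hz, hmax⟩ := hSc.exists_isMaxOn ⟨(t, r), hat, by simp⟩ hcont.continuousOn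
  set M := exp (-(l * (z.1 - a))) * |w z.1 z.2| with hM
  have hM0 : 0 ≤ M := by positivity
  have hwM : ∀ s ρ, a ≤ s → |ρ - r| ≤ t - s → |w s ρ| ≤ M * exp (l * (s - a)) := by
    intro s ρ hs hρ
    have h3 : exp (-(l * (s - a))) * |w s ρ| ≤ M := hmax (show (s, ρ) ∈ S from ⟨hs, hρ⟩)
    calc |w s ρ| = exp (-(l * (s - a))) * |w s ρ| * exp (l * (s - a)) := by
          rw [mul_right_comm, ← exp_add, neg_add_cancel, exp_zero, one_mul]
      _ ≤ _ := mul_le_mul_of_nonneg_right h3 (exp_pos _).le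
  have hwave' : ∀ s ρ, a ≤ s → |ρ - r| ≤ t - s →
      |_root_.dt (_root_.dt w) s ρ - _root_.dr (_root_.dr w) s ρ| ≤ L * M * exp (l * (s - a)) := by
    intro s ρ hs hρ
    refine (hwave s ρ hs hρ).trans ?_
    rw [mul_assoc]
    exact mul_le_mul_of_nonneg_left (hwM s ρ hs hρ) hL
  have hline : ∀ s ρ e, e ^ 2 = 1 → a ≤ s → |ρ - r| ≤ t - s →
      |_root_.dt w s ρ - e * _root_.dr w s ρ| ≤ L * M / l * exp (l * (s - a)) := by
    intro s ρ e he hs hρ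
    have habs : |e| = 1 := by
      rw [← sq_eq_sq₀ (abs_nonneg e) zero_le_one, sq_abs, he, one_pow]
    have hin : ∀ σ ≤ s, |ρ - e * s + e * σ - r| ≤ t - σ := fun σ hσ => by
      have h3 : ρ - e * s + e * σ - r = (ρ - r) + e * (σ - s) := by ring
      rw [h3]
      refine (abs_add_le _ _).trans ?_
      rw [abs_mul, habs, one_mul, abs_of_nonpos (by linarith : σ - s ≤ 0)]
      linarith
    have hd : ∀ σ, HasDerivAt (fun σ => _root_.dt w σ (ρ - e * s + e * σ)
        - e * _root_.dr w σ (ρ - e * s + e * σ))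
        (_root_.dt (_root_.dt w) σ (ρ - e * s + e * σ)
          - _root_.dr (_root_.dr w) σ (ρ - e * s + e * σ)) σ := by
      intro σ
      have e1 := hw.dt.hasDerivAt_comp_line 0 1 (ρ - e * s) e σ
      have e2 := hw.dr.hasDerivAt_comp_line 0 1 (ρ - e * s) e σ
      simp only [zero_add, one_mul] at e1 e2
      refine (e1.fun_sub (e2.const_mul e)).congr_deriv ?_
      rw [hw.dt_dr]
      linear_combination (-_root_.dr (_root_.dr w) σ (ρ - e * s + e * σ)) * he
    have h3 := abs_le_exp_of_abs_deriv_le hl0 (mul_nonneg hL hM0) hd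
      (by rw [h1 _ (hin a hs), h2 _ (hin a hs)]; simp) hs
      fun σ hσ => hwave' σ _ hσ.1 (hin σ hσ.2)
    simpa using h3
  have hdt : ∀ s ρ, a ≤ s → |ρ - r| ≤ t - s →
      |_root_.dt w s ρ| ≤ L * M / l * exp (l * (s - a)) := by
    intro s ρ hs hρ
    have e1 := abs_le.1 (hline s ρ 1 (by norm_num) hs hρ)
    have e2 := abs_le.1 (hline s ρ (-1) (by norm_num) hs hρ)
    exact abs_le.2 ⟨by linarith [e1.1, e2.1], by linarith [e1.2, e2.2]⟩
  have hfin := abs_le_exp_of_abs_deriv_le (f := fun s => w s z.2) hl0 (by positivity)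
    (fun s => hw.hasDerivAt_dt s z.2) (h0 z.2 (hz.2.trans (by linarith [hz.1]))) hz.1
    fun s hs => hdt s z.2 hs.1 (hz.2.trans (by linarith [hs.2]))
  have hMle : M ≤ L * M / l / l := by
    calc M ≤ exp (-(l * (z.1 - a))) * (L * M / l / l * exp (l * (z.1 - a))) :=
          mul_le_mul_of_nonneg_left hfin (exp_pos _).le
      _ = L * M / l / l := by
          rw [mul_left_comm, ← exp_add, neg_add_cancel, exp_zero, mul_one]
  have hM00 : M = 0 := by
    rw [div_div, le_div_iff₀ (by positivity)] at hMle
    by_contra hne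
    have hpos : 0 < M := lt_of_le_of_ne hM0 (Ne.symm hne)
    have : 0 < M * (l * l - L) := mul_pos hpos (by rw [hl]; nlinarith)
    linarith
  have := hwM t r hat (by simp)
  rw [hM00, zero_mul] at this
  exact abs_nonpos_iff.1 this

theorem Smooth₂.reflect {w : ℝ → ℝ → ℝ} (hw : Smooth₂ w) (c : ℝ) :
    Smooth₂ fun t r => w (c - t) r :=
  ContDiff.comp (g := fun p : ℝ × ℝ => w p.1 p.2) (f := fun p : ℝ × ℝ => (c - p.1, p.2)) hw
    ((contDiff_const.sub contDiff_fst).prodMk contDiff_snd)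

theorem Smooth₂.dt_reflect {w : ℝ → ℝ → ℝ} (hw : Smooth₂ w) (c t r : ℝ) :
    _root_.dt (fun t r => w (c - t) r) t r = -_root_.dt w (c - t) r := by
  refine HasDerivAt.deriv (f := fun s => w (c - s) r) ?_
  have := hw.hasDerivAt_comp_line c (-1) r 0 t
  simpa [sub_eq_add_neg] using this

theorem Smooth₂.dt_dt_reflect {w : ℝ → ℝ → ℝ} (hw : Smooth₂ w) (c t r : ℝ) :
    _root_.dt (_root_.dt fun t r => w (c - t) r) t r = _root_.dt (_root_.dt w) (c - t) r := by
  have h : _root_.dt (fun t r => w (c - t) r) = fun t r => -_root_.dt w (c - t) r := by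
    funext t r
    exact hw.dt_reflect c t r
  rw [h]
  refine HasDerivAt.deriv (f := fun s => -_root_.dt w (c - s) r) ?_
  have := (hw.dt.hasDerivAt_comp_line c (-1) r 0 t).fun_neg
  simpa [sub_eq_add_neg] using this

/-- The wave equation for `r φ` propagates vanishing of the Cauchy data, in both time directions. -/
theorem eq_zero_of_cauchyData_eq_zero {a b s t r : ℝ} {φ : ℝ → ℝ → ℝ} (hφ : Smooth₂ φ)
    (heqn : ∀ t ∈ Set.Icc a b, ∀ r,
      r * dt (dt φ) t r = r * dr (dr φ) t r + 2 * dr φ t r - r * nonlin (φ t r))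
    (hs : s ∈ Set.Icc a b) (ht : t ∈ Set.Icc a b)
    (h0 : ∀ ρ, |ρ - r| ≤ |t - s| → φ s ρ = 0 ∧ dt φ s ρ = 0 ∧ dr φ s ρ = 0) :
    r * φ t r = 0 := by
  set w : ℝ → ℝ → ℝ := fun t r => r * φ t r with hwdef
  have hw : Smooth₂ w := Smooth₂.snd.mul hφ
  have hwt : ∀ s ρ, dt w s ρ = ρ * dt φ s ρ := fun s ρ =>
    ((hφ.hasDerivAt_dt s ρ).const_mul ρ).deriv
  have hwr : ∀ s ρ, dr w s ρ = φ s ρ + ρ * dr φ s ρ := fun s ρ => by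
    rw [← one_mul (φ s ρ)]
    exact ((hasDerivAt_id' ρ).fun_mul (hφ.hasDerivAt_dr s ρ)).deriv
  have hwtt : ∀ s ρ, dt (dt w) s ρ = ρ * dt (dt φ) s ρ := fun s ρ => by
    rw [show dt w = fun s ρ => ρ * dt φ s ρ from funext fun s => funext (hwt s)]
    exact ((hφ.dt.hasDerivAt_dt s ρ).const_mul ρ).deriv
  have hwrr : ∀ s ρ, dr (dr w) s ρ = 2 * dr φ s ρ + ρ * dr (dr φ) s ρ := fun s ρ => by
    rw [show dr w = fun s ρ => φ s ρ + ρ * dr φ s ρ from funext fun s => funext (hwr s)]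
    refine HasDerivAt.deriv (f := fun ρ => φ s ρ + ρ * dr φ s ρ) ?_
    refine ((hφ.hasDerivAt_dr s ρ).fun_add
      ((hasDerivAt_id' ρ).fun_mul (hφ.dr.hasDerivAt_dr s ρ))).congr_deriv ?_
    ring
  have hcont : Continuous fun z : ℝ × ℝ => φ z.1 z.2 ^ 4 * log (2 + φ z.1 z.2 ^ 2) :=
    (hφ.continuous.pow 4).mul (continuous_log_two_add_sq.comp hφ.continuous)
  obtain ⟨L, hL⟩ := (isCompact_Icc (a := ((a, r - |t - s|) : ℝ × ℝ))
    (b := (b, r + |t - s|))).exists_bound_of_continuousOn hcont.continuousOn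
  have hwave : ∀ σ ∈ Set.Icc a b, ∀ ρ, |ρ - r| ≤ |t - s| →
      |dt (dt w) σ ρ - dr (dr w) σ ρ| ≤ |L| * |w σ ρ| := by
    intro σ hσ ρ hρ
    have h1 := abs_le.1 hρ
    have h2 := hL (σ, ρ) ⟨⟨hσ.1, by simp only; linarith⟩, ⟨hσ.2, by simp only; linarith⟩⟩
    have h3 : dt (dt w) σ ρ - dr (dr w) σ ρ
        = -((φ σ ρ ^ 4 * log (2 + φ σ ρ ^ 2)) * w σ ρ) := by
      rw [hwtt, hwrr, heqn σ hσ, nonlin, hwdef]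
      ring
    rw [h3, abs_neg, abs_mul]
    exact mul_le_mul_of_nonneg_right (h2.trans (le_abs_self L)) (abs_nonneg _)
  rcases le_total s t with hst | hst
  · rw [abs_of_nonneg (sub_nonneg.2 hst)] at h0 hwave
    refine hw.eq_zero_of_cauchyData_eq_zero hst (abs_nonneg L) (fun σ ρ hσ hρ => ?_)
      (fun ρ hρ => ?_) (fun ρ hρ => ?_) fun ρ hρ => ?_
    · have := abs_nonneg (ρ - r)
      exact hwave σ ⟨hs.1.trans hσ, by linarith [ht.2]⟩ ρ (by linarith)
    · simp [hwdef, (h0 ρ hρ).1]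
    · simp [hwt, (h0 ρ hρ).2.1]
    · simp [hwr, (h0 ρ hρ).1, (h0 ρ hρ).2.2]
  · rw [abs_of_nonpos (sub_nonpos.2 hst), neg_sub] at h0 hwave
    have h := (hw.reflect (s + t)).eq_zero_of_cauchyData_eq_zero (a := t) (t := s) (r := r)
      hst (abs_nonneg L) (fun σ ρ hσ hρ => ?_) (fun ρ hρ => ?_) (fun ρ hρ => ?_) fun ρ hρ => ?_
    · rwa [add_sub_cancel_left] at h
    · have := abs_nonneg (ρ - r)
      rw [hw.dt_dt_reflect]
      exact hwave (s + t - σ) ⟨by linarith [ht.1], by linarith [hs.2]⟩ ρ (by linarith)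
    · simp [hwdef, (h0 ρ hρ).1]
    · rw [hw.dt_reflect, hwt]
      simp [(h0 ρ hρ).2.1]
    · change dr w (s + t - t) ρ = 0
      rw [add_sub_cancel_right, hwr]
      simp [(h0 ρ hρ).1, (h0 ρ hρ).2.2]

theorem exists_radialWave {a b : ℝ} {φ : ℝ → ℝ → ℝ} (hab : a < b) (hφ : Smooth₂ φ)
    (heven : ∀ t ∈ Set.Icc a b, ∀ r, φ t (-r) = φ t r)
    (hsupp : ∀ t ∈ Set.Icc a b, ∃ R, VanishesOff R (φ t))
    (heqn : ∀ t ∈ Set.Icc a b, ∀ r,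
      r * dt (dt φ) t r = r * dr (dr φ) t r + 2 * dr φ t r - r * nonlin (φ t r)) :
    ∃ R, 0 ≤ R ∧ RadialWave a b R φ := by
  let F : ℕ → Set (Set.Icc a b) := fun n => {t | ∀ r, (n : ℝ) ≤ |r| → φ t r = 0}
  have hF : ∀ n, IsClosed (F n) := fun n => by
    simp only [F, Set.ofPred_forall]
    refine isClosed_iInter fun r => isClosed_iInter fun _ => ?_
    exact isClosed_eq (hφ.continuous_comp continuous_subtype_val continuous_const)
      continuous_const
  have hU : ⋃ n, F n = Set.univ := Set.eq_univ_of_forall fun t => by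
    obtain ⟨R, hR⟩ := hsupp t t.2
    obtain ⟨n, hn⟩ := exists_nat_ge R
    exact Set.mem_iUnion.2 ⟨n, fun r hr => hR r (hn.trans hr)⟩
  have : Nonempty (Set.Icc a b) := ⟨⟨a, le_rfl, hab.le⟩⟩
  have : CompactSpace (Set.Icc a b) := isCompact_iff_compactSpace.1 isCompact_Icc
  obtain ⟨n, s, hs⟩ := nonempty_interior_of_iUnion_of_closed hF hU
  have hnhds := mem_nhds_subtype_iff_nhdsWithin.1 (mem_interior_iff_mem_nhds.1 hs)
  have hs0 : VanishesOff n (φ s) := interior_subset hs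
  have hdata : ∀ ρ, (n : ℝ) + 1 ≤ |ρ| → φ s ρ = 0 ∧ dt φ s ρ = 0 ∧ dr φ s ρ = 0 := by
    intro ρ hρ
    refine ⟨hs0 ρ (by linarith), ?_, hs0.deriv (lt_add_one _) ρ hρ⟩
    have h1 : (fun σ => φ σ ρ) =ᶠ[nhdsWithin (s : ℝ) (Set.Icc a b)] fun _ => 0 := by
      filter_upwards [hnhds]
      rintro _ ⟨σ, hσ, rfl⟩
      exact hσ ρ (by linarith)
    have h2 := h1.derivWithin_eq (hs0 ρ (by linarith))
    rw [(hφ.hasDerivAt_dt s ρ).differentiableAt.derivWithin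
      (uniqueDiffOn_Icc hab _ s.2)] at h2
    simpa [dt] using h2
  have hpos : ∀ t ∈ Set.Icc a b, ∀ r, (n : ℝ) + 1 + (b - a) ≤ r → φ t r = 0 := by
    intro t ht r hr
    have hts : |t - s| ≤ b - a := abs_le.2
      ⟨by linarith [ht.1, s.2.2], by linarith [ht.2, s.2.1]⟩
    have h1 := eq_zero_of_cauchyData_eq_zero (r := r) hφ heqn s.2 ht fun ρ hρ => hdata ρ (by
      have := (abs_le.1 (hρ.trans hts)).1
      have := le_abs_self ρ
      linarith)
    have hr0 : r ≠ 0 := by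
      have : (0 : ℝ) ≤ n := n.cast_nonneg
      have : 0 < r := by linarith
      exact this.ne'
    exact (mul_eq_zero.1 h1).resolve_left hr0
  refine ⟨n + 1 + (b - a), by have : (0 : ℝ) ≤ n := n.cast_nonneg; linarith,
    hab, hφ, heven, fun t ht r hr => ?_, heqn⟩
  rcases abs_cases r with ⟨h, _⟩ | ⟨h, _⟩
  · exact hpos t ht r (h ▸ hr)
  · rw [← heven t ht]
    exact hpos t ht (-r) (h ▸ hr)

theorem hasFDerivAt_norm_of_ne_zero {x : Sp} (hx : x ≠ 0) :
    HasFDerivAt (fun y : Sp => ‖y‖) (‖x‖⁻¹ • innerSL ℝ x) x := by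
  have h0 : ‖x‖ ≠ 0 := norm_ne_zero_iff.2 hx
  have h := (hasStrictFDerivAt_norm_sq x).hasFDerivAt.sqrt (pow_ne_zero 2 h0)
  simp only [Real.sqrt_sq (norm_nonneg _)] at h
  refine h.congr_fderiv ?_
  ext y
  simp only [smul_apply, smul_eq_mul, nsmul_eq_mul]
  push_cast
  field_simp

theorem pd_radial {v : Sp → ℝ} {ψ : ℝ → ℝ} {ψ' : ℝ} {x : Sp} (i : Fin 3) (hx : x ≠ 0)
    (hv : v =ᶠ[nhds x] fun y => ψ ‖y‖) (hψ : HasDerivAt ψ ψ' ‖x‖) :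
    pd i v x = ψ' * (x i / ‖x‖) := by
  have h : HasFDerivAt v (ψ' • (‖x‖⁻¹ • innerSL ℝ x)) x :=
    (hψ.comp_hasFDerivAt x (hasFDerivAt_norm_of_ne_zero hx)).congr_of_eventuallyEq hv
  rw [pd, h.fderiv]
  simp only [smul_apply, smul_eq_mul, innerSL_apply_apply, EuclideanSpace.inner_single_right,
    conj_trivial, one_mul]
  ring

/-- The Hessian of a radial function away from the origin. -/
theorem pd_pd_radial {v : Sp → ℝ} {ψ ψ' : ℝ → ℝ} {ψ'' : ℝ} {x : Sp} (i j : Fin 3) (hx : x ≠ 0)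
    (hv : ∀ y, v y = ψ ‖y‖) (hψ : ∀ r, HasDerivAt ψ (ψ' r) r) (hψ' : HasDerivAt ψ' ψ'' ‖x‖) :
    pd j (pd i v) x = (ψ'' - ψ' ‖x‖ / ‖x‖) * (x i / ‖x‖) * (x j / ‖x‖)
      + ψ' ‖x‖ / ‖x‖ * (if i = j then 1 else 0) := by
  have h0 : ‖x‖ ≠ 0 := norm_ne_zero_iff.2 hx
  have h1 : pd i v =ᶠ[nhds x] fun y => ψ' ‖y‖ / ‖y‖ * y i := by
    filter_upwards [isOpen_ne.mem_nhds hx] with y hy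
    rw [pd_radial i hy (Filter.Eventually.of_forall hv) (hψ _)]
    ring
  have h2 : HasDerivAt (fun r => ψ' r / r) ((ψ'' * ‖x‖ - ψ' ‖x‖ * 1) / ‖x‖ ^ 2) ‖x‖ :=
    hψ'.fun_div (hasDerivAt_id' _) h0
  have h3 : HasFDerivAt (fun y : Sp => y i) (EuclideanSpace.proj (𝕜 := ℝ) i) x :=
    (EuclideanSpace.proj (𝕜 := ℝ) (ι := Fin 3) i).hasFDerivAt
  have h4 := ((h2.comp_hasFDerivAt x (hasFDerivAt_norm_of_ne_zero hx)).mul h3).congr_of_eventuallyEq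
    h1
  rw [pd, h4.fderiv]
  simp [EuclideanSpace.inner_single_right]
  field_simp
  ring

theorem sum_sq_div_norm {x : Sp} (hx : x ≠ 0) : ∑ i, (x i / ‖x‖) ^ 2 = 1 := by
  have h0 : ‖x‖ ≠ 0 := norm_ne_zero_iff.2 hx
  simp only [div_pow]
  rw [← Finset.sum_div, ← EuclideanSpace.real_norm_sq_eq, div_self (pow_ne_zero 2 h0)]

theorem lap_radial {v : Sp → ℝ} {ψ ψ' : ℝ → ℝ} {ψ'' : ℝ} {x : Sp} (hx : x ≠ 0)
    (hv : ∀ y, v y = ψ ‖y‖) (hψ : ∀ r, HasDerivAt ψ (ψ' r) r) (hψ' : HasDerivAt ψ' ψ'' ‖x‖) :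
    lap v x = ψ'' + 2 * (ψ' ‖x‖ / ‖x‖) := by
  have h := sum_sq_div_norm hx
  simp only [lap, pd_pd_radial _ _ hx hv hψ hψ']
  rw [Fin.sum_univ_three] at h ⊢
  simp only [if_true]
  linear_combination (ψ'' - ψ' ‖x‖ / ‖x‖) * h

theorem sum_pd_sq_radial {v : Sp → ℝ} {ψ ψ' : ℝ → ℝ} {x : Sp} (hx : x ≠ 0)
    (hv : ∀ y, v y = ψ ‖y‖) (hψ : ∀ r, HasDerivAt ψ (ψ' r) r) :
    ∑ i, pd i v x ^ 2 = ψ' ‖x‖ ^ 2 := by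
  have h := sum_sq_div_norm hx
  simp only [fun i => pd_radial i hx (Filter.Eventually.of_forall hv) (hψ _), mul_pow]
  rw [← Finset.mul_sum, h, mul_one]

theorem sum_pd_pd_sq_radial {v : Sp → ℝ} {ψ ψ' : ℝ → ℝ} {ψ'' : ℝ} {x : Sp} (hx : x ≠ 0)
    (hv : ∀ y, v y = ψ ‖y‖) (hψ : ∀ r, HasDerivAt ψ (ψ' r) r) (hψ' : HasDerivAt ψ' ψ'' ‖x‖) :
    ∑ i, ∑ j, pd j (pd i v) x ^ 2 = ψ'' ^ 2 + 2 * (ψ' ‖x‖ / ‖x‖) ^ 2 := by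
  have h := sum_sq_div_norm hx
  simp only [pd_pd_radial _ _ hx hv hψ hψ']
  simp only [Fin.sum_univ_three] at h ⊢
  simp
  set n0 := x 0 / ‖x‖
  set n1 := x 1 / ‖x‖
  set n2 := x 2 / ‖x‖
  set q := ψ' ‖x‖ / ‖x‖
  linear_combination ((ψ'' - q) ^ 2 * (n0 ^ 2 + n1 ^ 2 + n2 ^ 2 + 1) + 2 * (ψ'' - q) * q) * h

/-- The area of the unit sphere. -/
def sphereArea : ℝ := 3 * volume.real (Metric.ball (0 : Sp) 1)

theorem sphereArea_pos : 0 < sphereArea :=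
  mul_pos three_pos (ENNReal.toReal_pos (Metric.measure_ball_pos _ _ one_pos).ne'
    measure_ball_lt_top.ne)

theorem integral_Ioi_eq_of_eq_zero {k : ℝ → ℝ} {M : ℝ} (hM : 0 ≤ M) (hk : ∀ r, M ≤ r → k r = 0) :
    ∫ r in Set.Ioi (0 : ℝ), k r = ∫ r in (0 : ℝ)..M, k r := by
  rw [intervalIntegral.integral_of_le hM]
  refine setIntegral_eq_of_subset_of_forall_sdiff_eq_zero measurableSet_Ioi
    Set.Ioc_subset_Ioi_self fun r hr => hk r ?_
  by_contra! h
  exact hr.2 ⟨hr.1, h.le⟩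

/-- Integration in polar coordinates. -/
theorem integral_radial {g : Sp → ℝ} {G k : ℝ → ℝ} (hg : ∀ x, x ≠ 0 → g x = G ‖x‖)
    (hk : ∀ r, 0 < r → r ^ 2 * G r = k r) :
    ∫ x, g x = sphereArea * ∫ r in Set.Ioi (0 : ℝ), k r := by
  have h1 : ∫ x, g x = ∫ x : Sp, G ‖x‖ :=
    integral_congr_ae ((Measure.ae_ne volume 0).mono fun x hx => hg x hx)
  rw [h1, integral_fun_norm_addHaar]
  simp only [finrank_euclideanSpace, Fintype.card_fin, nsmul_eq_mul, smul_eq_mul]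
  rw [sphereArea, mul_assoc]
  push_cast
  congr 2
  exact setIntegral_congr_fun measurableSet_Ioi fun r hr => hk r hr

/-- The radial profile of a function on space-time. -/
def profile (u : ℝ → Sp → ℝ) (t r : ℝ) : ℝ := u t (r • EuclideanSpace.single 0 1)

section Profile

variable {a b t : ℝ} {u : ℝ → Sp → ℝ}

theorem norm_smul_single (r : ℝ) : ‖r • (EuclideanSpace.single 0 1 : Sp)‖ = |r| := by
  rw [norm_smul, PiLp.norm_single]
  simp

theorem smooth_profile (hu : ContDiff ℝ (⊤ : ℕ∞) fun p : ℝ × Sp => u p.1 p.2) :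
    Smooth₂ (profile u) :=
  ContDiff.comp (g := fun p : ℝ × Sp => u p.1 p.2)
    (f := fun p : ℝ × ℝ => (p.1, p.2 • (EuclideanSpace.single 0 1 : Sp))) hu
    (contDiff_fst.prodMk (contDiff_snd.smul contDiff_const))

theorem eq_profile (hrad : IsRadialSolution (Set.Icc a b) u) (ht : t ∈ Set.Icc a b) (x : Sp) :
    u t x = profile u t ‖x‖ :=
  hrad t ht _ _ (by rw [norm_smul_single, abs_norm])

theorem deriv_eq_dt_profile (hu : ContDiff ℝ (⊤ : ℕ∞) fun p : ℝ × Sp => u p.1 p.2)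
    (hrad : IsRadialSolution (Set.Icc a b) u) (hab : a < b) (ht : t ∈ Set.Icc a b) (x : Sp) :
    deriv (fun s => u s x) t = dt (profile u) t ‖x‖ := by
  refine deriv_eq_of_eqOn_Icc hab ht ?_ ((smooth_profile hu).hasDerivAt_dt t _).differentiableAt
    fun s hs => eq_profile hrad hs x
  exact (ContDiff.differentiable_top (hu.comp (contDiff_id.prodMk contDiff_const))) t

theorem deriv_pd_eq (hu : ContDiff ℝ (⊤ : ℕ∞) fun p : ℝ × Sp => u p.1 p.2)
    (hrad : IsRadialSolution (Set.Icc a b) u) (hab : a < b) (ht : t ∈ Set.Icc a b) {x : Sp}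
    (hx : x ≠ 0) (i : Fin 3) :
    deriv (fun s => pd i (u s) x) t = dr (dt (profile u)) t ‖x‖ * (x i / ‖x‖) := by
  have hφ := smooth_profile hu
  have h1 : ∀ s, pd i (u s) x
      = fderiv ℝ (fun p : ℝ × Sp => u p.1 p.2) (s, x) (0, EuclideanSpace.single i 1) := fun s => by
    have h2 := (ContDiff.differentiable_top hu (s, x)).hasFDerivAt.comp x
      (hasFDerivAt_prodMk_right s x)
    have h3 : HasFDerivAt (u s) _ x := h2
    rw [pd, h3.fderiv]
    simp
  have h2 : DifferentiableAt ℝ (fun s => pd i (u s) x) t := by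
    simp only [h1]
    exact (ContDiff.differentiable_top ((ContDiff.directional_deriv hu _).comp
      (contDiff_id.prodMk contDiff_const))) t
  have h3 := (hφ.dr.hasDerivAt_dt t ‖x‖).mul_const (x i / ‖x‖)
  rw [deriv_eq_of_eqOn_Icc hab ht h2 h3.differentiableAt fun s hs =>
    pd_radial i hx (Filter.Eventually.of_forall (eq_profile hrad hs)) (hφ.hasDerivAt_dr s _),
    h3.deriv, hφ.dt_dr]

theorem profile_eqn (hu : IsClassicalSolution (Set.Icc a b) u)
    (hrad : IsRadialSolution (Set.Icc a b) u) (hab : a < b) (ht : t ∈ Set.Icc a b) (r : ℝ) :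
    r * dt (dt (profile u)) t r = r * dr (dr (profile u)) t r + 2 * dr (profile u) t r
      - r * nonlin (profile u t r) := by
  have hφ := smooth_profile hu.1
  have heven : ∀ s ∈ Set.Icc a b, ∀ r, profile u s (-r) = profile u s r := fun s hs r =>
    hrad s hs _ _ (by rw [norm_smul_single, norm_smul_single, abs_neg])
  have hodd : ∀ r, dr (profile u) t (-r) = -dr (profile u) t r :=
    RadialWave.deriv_neg_of_even (heven t ht)
  have hpos : ∀ r : ℝ, 0 < r → dt (dt (profile u)) t r = dr (dr (profile u)) t r
      + 2 * (dr (profile u) t r / r) - nonlin (profile u t r) := by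
    intro r hr
    set x : Sp := r • EuclideanSpace.single 0 1
    have hxn : ‖x‖ = r := by rw [norm_smul_single, abs_of_pos hr]
    have hx : x ≠ 0 := norm_ne_zero_iff.1 (by rw [hxn]; exact hr.ne')
    have h1 := hu.2.2 t ht x
    rw [lap_radial hx (eq_profile hrad ht) (hφ.hasDerivAt_dr t) (hφ.dr.hasDerivAt_dr t _),
      hxn] at h1
    exact h1
  have hpos' : ∀ r : ℝ, 0 < r → r * dt (dt (profile u)) t r = r * dr (dr (profile u)) t r
      + 2 * dr (profile u) t r - r * nonlin (profile u t r) := by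
    intro r hr
    rw [hpos r hr]
    field_simp
  rcases lt_trichotomy r 0 with hr | rfl | hr
  · have h1 : dt (dt (profile u)) t (-r) = dt (dt (profile u)) t r :=
      deriv_eq_of_eqOn_Icc hab ht (hφ.dt.hasDerivAt_dt t _).differentiableAt
        (hφ.dt.hasDerivAt_dt t _).differentiableAt fun s hs =>
          deriv_eq_of_eqOn_Icc hab hs (hφ.hasDerivAt_dt s _).differentiableAt
            (hφ.hasDerivAt_dt s _).differentiableAt fun s hs => heven s hs r
    have h2 : dr (dr (profile u)) t (-r) = dr (dr (profile u)) t r := by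
      have h3 := ((hφ.dr.hasDerivAt_dr t (-r)).comp r (hasDerivAt_neg r)).neg
      have h4 : (-(dr (profile u) t ∘ Neg.neg)) = dr (profile u) t := by
        ext r
        simp [hodd]
      rw [h4] at h3
      simpa using h3.unique (hφ.dr.hasDerivAt_dr t r)
    have h := hpos' (-r) (neg_pos.2 hr)
    rw [h1, h2, hodd, heven t ht] at h
    linarith
  · have h := hodd 0
    rw [neg_zero] at h
    linarith
  · exact hpos' r hr

theorem profile_vanishesOff (hu : HasCompactSupport (u t)) :
    ∃ R, VanishesOff R (profile u t) := by
  obtain ⟨C, hC⟩ := hu.isCompact.isBounded.exists_norm_le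
  refine ⟨C + 1, fun r hr => ?_⟩
  by_contra h
  have h1 := hC _ (subset_tsupport _ h)
  rw [norm_smul_single] at h1
  linarith

/-- The profile of a radial classical solution solves the radial wave equation. -/
theorem exists_radialWave_profile (hu : IsClassicalSolution (Set.Icc a b) u)
    (hrad : IsRadialSolution (Set.Icc a b) u) (hab : a < b) :
    ∃ R, 0 ≤ R ∧ RadialWave a b R (profile u) :=
  exists_radialWave hab (smooth_profile hu.1)
    (fun t ht r => hrad t ht _ _ (by rw [norm_smul_single, norm_smul_single, abs_neg]))
    (fun t ht => profile_vanishesOff (hu.2.1 t ht))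
    fun t ht r => profile_eqn hu hrad hab ht r

end Profile

theorem integral_radial_of_vanishing {g : Sp → ℝ} {G k : ℝ → ℝ} {M : ℝ} (hM : 0 ≤ M)
    (hg : ∀ x, x ≠ 0 → g x = G ‖x‖) (hk : ∀ r, 0 < r → r ^ 2 * G r = k r)
    (hv : VanishesOff M k) : ∫ x, g x = sphereArea / 2 * (2 * ∫ r in (0 : ℝ)..M, k r) := by
  rw [integral_radial hg hk, integral_Ioi_eq_of_eq_zero hM fun r hr =>
    hv r (hr.trans (le_abs_self r))]
  ring

namespace RadialWave

variable {a b R t : ℝ} {u : ℝ → Sp → ℝ}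

theorem energy_vanishes {φ : ℝ → ℝ → ℝ} (H : RadialWave a b R φ) (ht : t ∈ Set.Icc a b) :
    VanishesOff (R + 2) fun r => (r * dt φ t r) ^ 2 + (r * dr φ t r) ^ 2 := fun r hr => by
  simp [H.dt_vanishes ht r (by linarith),
    (H.vanishes t ht).deriv (show R < R + 2 by linarith) r hr, dr]

theorem energy_dr_vanishes {φ : ℝ → ℝ → ℝ} (H : RadialWave a b R φ) (ht : t ∈ Set.Icc a b) :
    VanishesOff (R + 2) fun r =>
      (r * dr (dt φ) t r) ^ 2 + (r * dr (dr φ) t r) ^ 2 + 2 * dr φ t r ^ 2 := fun r hr => by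
  have h1 := (H.dt_vanishes ht).deriv (show R < R + 2 by linarith) r hr
  have h2 : VanishesOff (R + 1) (dr φ t) := (H.vanishes t ht).deriv (by linarith)
  have h3 := h2.deriv (show R + 1 < R + 2 by linarith) r hr
  have h4 := h2 r (by linarith)
  unfold dr at h1 h3 h4 ⊢
  simp [h1, h3, h4]

theorem integral_energy (H : RadialWave a b R (profile u)) (hR : 0 ≤ R)
    (hu : ContDiff ℝ (⊤ : ℕ∞) fun p : ℝ × Sp => u p.1 p.2)
    (hrad : IsRadialSolution (Set.Icc a b) u) (ht : t ∈ Set.Icc a b) :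
    ∫ x, ((deriv (fun s => u s x) t) ^ 2 + ∑ i, (pd i (u t) x) ^ 2)
      = sphereArea / 2 * n2 (outgoing (profile u) t) ^ 2 := by
  rw [H.n2_outgoing_sq ht hR]
  refine integral_radial_of_vanishing (by linarith)
    (G := fun r => dt (profile u) t r ^ 2 + dr (profile u) t r ^ 2) (fun x hx => ?_)
    (fun r _ => by ring) (H.energy_vanishes ht)
  rw [sum_pd_sq_radial hx (eq_profile hrad ht) (H.smooth.hasDerivAt_dr t),
    deriv_eq_dt_profile hu hrad H.lt ht]

theorem integral_energy_dr (H : RadialWave a b R (profile u)) (hR : 0 ≤ R)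
    (hu : ContDiff ℝ (⊤ : ℕ∞) fun p : ℝ × Sp => u p.1 p.2)
    (hrad : IsRadialSolution (Set.Icc a b) u) (ht : t ∈ Set.Icc a b) :
    ∫ x, (∑ i, (deriv (fun s => pd i (u s) x) t) ^ 2 + ∑ i, ∑ j, (pd j (pd i (u t)) x) ^ 2)
      = sphereArea / 2 * n2 (dr (outgoing (profile u)) t) ^ 2 := by
  rw [H.n2_dr_outgoing_sq ht hR]
  refine integral_radial_of_vanishing (by linarith)
    (G := fun r => dr (dt (profile u)) t r ^ 2 + (dr (dr (profile u)) t r ^ 2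
      + 2 * (dr (profile u) t r / r) ^ 2)) (fun x hx => ?_)
    (fun r hr => by field_simp; ring) (H.energy_dr_vanishes ht)
  rw [sum_pd_pd_sq_radial hx (eq_profile hrad ht) (H.smooth.hasDerivAt_dr t)
    (H.smooth.dr.hasDerivAt_dr t _)]
  simp only [deriv_pd_eq hu hrad H.lt ht hx, mul_pow]
  rw [← Finset.mul_sum, sum_sq_div_norm hx, mul_one]

theorem Dquant_sq (H : RadialWave a b R (profile u)) (hR : 0 ≤ R)
    (hu : ContDiff ℝ (⊤ : ℕ∞) fun p : ℝ × Sp => u p.1 p.2)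
    (hrad : IsRadialSolution (Set.Icc a b) u) (ht : t ∈ Set.Icc a b) :
    Dquant u t ^ 2 = sphereArea / 2 * (n2 (outgoing (profile u) t) ^ 2
      + n2 (dr (outgoing (profile u)) t) ^ 2) := by
  have hφ := H.smooth
  have c1 : Continuous fun r => (r * dt (profile u) t r) ^ 2 + (r * dr (profile u) t r) ^ 2 := by
    have h1 := continuous_at hφ.dt t
    have h2 := continuous_at hφ.dr t
    fun_prop
  have c2 : Continuous fun r => (r * dr (dt (profile u)) t r) ^ 2
      + (r * dr (dr (profile u)) t r) ^ 2 + 2 * dr (profile u) t r ^ 2 := by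
    have h1 := continuous_at hφ.dt.dr t
    have h2 := continuous_at hφ.dr.dr t
    have h3 := continuous_at hφ.dr t
    fun_prop
  rw [Dquant, Real.sq_sqrt (integral_nonneg fun x => by positivity), H.n2_outgoing_sq ht hR,
    H.n2_dr_outgoing_sq ht hR, ← mul_add, ← intervalIntegral.integral_add
      (c1.intervalIntegrable _ _) (c2.intervalIntegrable _ _)]
  refine integral_radial_of_vanishing (by linarith)
    (G := fun r => dt (profile u) t r ^ 2 + dr (profile u) t r ^ 2 + dr (dt (profile u)) t r ^ 2
      + (dr (dr (profile u)) t r ^ 2 + 2 * (dr (profile u) t r / r) ^ 2)) (fun x hx => ?_)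
    (fun r hr => by field_simp; ring) fun r hr => ?_
  · rw [Finset.sum_comm, sum_pd_pd_sq_radial hx (eq_profile hrad ht) (hφ.hasDerivAt_dr t)
      (hφ.dr.hasDerivAt_dr t _), sum_pd_sq_radial hx (eq_profile hrad ht) (hφ.hasDerivAt_dr t),
      sum_pd_sq_radial hx (deriv_eq_dt_profile hu hrad H.lt ht) (hφ.dt.hasDerivAt_dr t),
      deriv_eq_dt_profile hu hrad H.lt ht]
  · have h1 := H.energy_vanishes ht r hr
    have h2 := H.energy_dr_vanishes ht r hr
    exact (congrArg₂ (· + ·) h1 h2).trans (add_zero 0)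

theorem Aquant_eq (H : RadialWave a b R (profile u))
    (hrad : IsRadialSolution (Set.Icc a b) u) :
    Aquant (Set.Icc a b) u = sphereArea / 2 * ∫ t in a..b, density (profile u) t := by
  rw [Aquant, intervalIntegral.integral_of_le H.lt.le, ← integral_Icc_eq_integral_Ioc,
    ← integral_const_mul]
  refine setIntegral_congr_fun measurableSet_Icc fun t ht => ?_
  have h1 : density (profile u) t = ∫ r, (fun r => r ^ 2 *
      (|profile u t r| ^ 8 * log (2 + profile u t r ^ 2))) |r| := by
    refine integral_congr_ae (Filter.Eventually.of_forall fun r => ?_)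
    rcases abs_choice r with h | h <;> simp [h, H.even t ht]
  rw [h1, integral_comp_abs (f := fun r => r ^ 2 *
    (|profile u t r| ^ 8 * log (2 + profile u t r ^ 2))), integral_radial
    (G := fun r => |profile u t r| ^ 8 * log (2 + profile u t r ^ 2))
    (fun x _ => by rw [eq_profile hrad ht]) (fun r _ => rfl)]
  ring

theorem sum_pd_sq_eq (H : RadialWave a b R (profile u))
    (hrad : IsRadialSolution (Set.Icc a b) u) (ht : t ∈ Set.Icc a b) (x : Sp) :
    ∑ i, pd i (u t) x ^ 2 = dr (profile u) t ‖x‖ ^ 2 := by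
  rcases eq_or_ne x 0 with rfl | hx
  · have h1 : fderiv ℝ (u t) 0 = 0 := by
      by_cases hd : DifferentiableAt ℝ (u t) 0
      · have h2 : HasFDerivAt (u t) (fderiv ℝ (u t) 0) (-0 : Sp) := by
          rw [neg_zero]
          exact hd.hasFDerivAt
        have h3 := h2.comp 0 (hasFDerivAt_id (𝕜 := ℝ) (0 : Sp)).neg
        have h4 : u t ∘ Neg.neg = u t := funext fun x => hrad t ht _ _ (norm_neg x)
        rw [h4] at h3
        have h5 := hd.hasFDerivAt.unique h3
        rw [ContinuousLinearMap.comp_neg, ContinuousLinearMap.comp_id] at h5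
        ext y
        simpa [self_eq_neg] using DFunLike.congr_fun h5 y
      · exact fderiv_zero_of_not_differentiableAt hd
    simp [pd, h1, H.dr_zero ht]
  · exact sum_pd_sq_radial hx (eq_profile hrad ht) (H.smooth.hasDerivAt_dr t)

end RadialWave

theorem log_two_add_sq_le {c D K : ℝ} (hc : 0 ≤ c) (hD : 0 ≤ D) (hK : 0 ≤ K) (h : K ≤ c * D) :
    log (2 + (K + 1) ^ 2) ≤ (2 * log (c + 2) / log 2 + 2) * log (2 + D) := by
  have h2 : 0 < log 2 := log_pos one_lt_two
  have h3 : log 2 ≤ log (2 + D) := log_le_log two_pos (by linarith)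
  have h4 : 0 ≤ log (c + 2) := log_nonneg (by linarith)
  have h5 : 2 + (K + 1) ^ 2 ≤ ((c + 2) * (2 + D)) ^ 2 := by
    have h6 : (K + 1) ^ 2 ≤ (c * D + 1) ^ 2 := pow_le_pow_left₀ (by linarith) (by linarith) 2
    have h7 : 0 ≤ c * D := mul_nonneg hc hD
    nlinarith [mul_nonneg h7 hc, mul_nonneg h7 hD]
  calc log (2 + (K + 1) ^ 2) ≤ log (((c + 2) * (2 + D)) ^ 2) := log_le_log (by positivity) h5
    _ = 2 * log (c + 2) / log 2 * log 2 + 2 * log (2 + D) := by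
        rw [log_pow, log_mul (by positivity) (by positivity)]
        field_simp
        push_cast
        ring
    _ ≤ 2 * log (c + 2) / log 2 * log (2 + D) + 2 * log (2 + D) := by gcongr
    _ = _ := by ring

theorem sqrt_integral_iSup_sq_le {a b K : ℝ} {w : ℝ → Sp → ℝ} {m : ℝ → ℝ} (hK : 0 ≤ K)
    (hw0 : ∀ t x, 0 ≤ w t x) (hm0 : ∀ t, 0 ≤ m t) (hm : MemLp m 2)
    (hmi : ∫ t, m t ^ 2 ≤ 20 * K ^ 2) (hw : ∀ t ∈ Set.Icc a b, ∀ x, w t x ≤ m t) :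
    √(∫ t in Set.Icc a b, (⨆ x, w t x) ^ 2) ≤ 5 * K := by
  refine Real.sqrt_le_iff.2 ⟨by positivity, ?_⟩
  have h1 : ∫ t in Set.Icc a b, (⨆ x, w t x) ^ 2 ≤ ∫ t in Set.Icc a b, m t ^ 2 := by
    refine integral_mono_of_nonneg (Filter.Eventually.of_forall fun t => sq_nonneg _)
      hm.integrable_sq.integrableOn ?_
    filter_upwards [ae_restrict_mem measurableSet_Icc] with t ht
    exact pow_le_pow_left₀ (Real.iSup_nonneg (hw0 t)) (Real.iSup_le (hw t ht) (hm0 t)) 2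
  have h2 : ∫ t in Set.Icc a b, m t ^ 2 ≤ ∫ t, m t ^ 2 :=
    setIntegral_le_integral hm.integrable_sq (Filter.Eventually.of_forall fun t => sq_nonneg _)
  nlinarith [sq_nonneg K]

theorem sqrt_energy_le {E n K : ℝ} (hE : E = sphereArea / 2 * n ^ 2) (hn : 0 ≤ n) (hnK : n ≤ K) :
    √E ≤ √sphereArea * K := by
  have hκ := sphereArea_pos
  refine Real.sqrt_le_iff.2 ⟨mul_nonneg (Real.sqrt_nonneg _) (hn.trans hnK), ?_⟩
  rw [hE, mul_pow, Real.sq_sqrt hκ.le]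
  have := mul_le_mul_of_nonneg_left (pow_le_pow_left₀ hn hnK 2) hκ.le
  nlinarith [mul_nonneg hκ.le (sq_nonneg n)]

namespace RadialWave

variable {a b R t : ℝ} {u : ℝ → Sp → ℝ}

theorem Dquant_le (H : RadialWave a b R (profile u)) (hR : 0 ≤ R)
    (hu : ContDiff ℝ (⊤ : ℕ∞) fun p : ℝ × Sp => u p.1 p.2)
    (hrad : IsRadialSolution (Set.Icc a b) u) (ht : t ∈ Set.Icc a b) :
    Dquant u t ≤ √sphereArea * control (profile u) a b := by
  have hκ := sphereArea_pos
  have hK : 0 ≤ control (profile u) a b := control_nonneg H.lt.le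
  obtain ⟨h1, h2, -⟩ := (H.estimates hR (Set.right_mem_Icc.2 H.lt.le)).1 t ht
  refine abs_le_of_sq_le_sq' ?_ (by positivity) |>.2
  rw [H.Dquant_sq hR hu hrad ht, mul_pow, Real.sq_sqrt hκ.le]
  have h3 := mul_le_mul_of_nonneg_left (add_le_add (pow_le_pow_left₀ (n2_nonneg _) h1 2)
    (pow_le_pow_left₀ (n2_nonneg _) h2 2)) hκ.le
  linarith

theorem initial_le (H : RadialWave a b R (profile u)) (hR : 0 ≤ R)
    (hu : ContDiff ℝ (⊤ : ℕ∞) fun p : ℝ × Sp => u p.1 p.2)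
    (hrad : IsRadialSolution (Set.Icc a b) u) :
    √sphereArea * initial (profile u) a ≤ 2 * Dquant u a := by
  have hκ := sphereArea_pos
  have hD : 0 ≤ Dquant u a := Real.sqrt_nonneg _
  refine abs_le_of_sq_le_sq' ?_ (by positivity) |>.2
  rw [mul_pow, mul_pow, H.Dquant_sq hR hu hrad (Set.left_mem_Icc.2 H.lt.le),
    Real.sq_sqrt hκ.le, initial]
  have h3 := mul_le_mul_of_nonneg_left (add_sq_le (a := n2 (outgoing (profile u) a))
    (b := n2 (dr (outgoing (profile u)) a))) hκ.le
  linarith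

theorem Bquant_le (H : RadialWave a b R (profile u)) (hR : 0 ≤ R)
    (hu : ContDiff ℝ (⊤ : ℕ∞) fun p : ℝ × Sp => u p.1 p.2)
    (hrad : IsRadialSolution (Set.Icc a b) u) :
    Bquant (Set.Icc a b) u ≤ (10 + 2 * √sphereArea) * control (profile u) a b := by
  have hK : 0 ≤ control (profile u) a b := control_nonneg H.lt.le
  obtain ⟨h1, m₀, m₁, hm₀, hm₀L, hm₀i, hm₁, hm₁L, hm₁i, hm⟩ :=
    H.estimates hR (Set.right_mem_Icc.2 H.lt.le)
  have e1 := sqrt_integral_iSup_sq_le (a := a) (b := b) (w := fun t x => |u t x|) hK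
    (fun t x => abs_nonneg _) hm₀ hm₀L hm₀i fun t ht x => by
      rw [eq_profile hrad ht]
      exact (hm t ht _).1
  have e3 := sqrt_integral_iSup_sq_le (a := a) (b := b)
    (w := fun t x => √(∑ i, (pd i (u t) x) ^ 2)) hK
    (fun t x => Real.sqrt_nonneg _) hm₁ hm₁L hm₁i fun t ht x => by
      rw [H.sum_pd_sq_eq hrad ht, Real.sqrt_sq_eq_abs]
      exact (hm t ht _).2
  have hsK : 0 ≤ √sphereArea * control (profile u) a b := by positivity
  have e2 : ⨆ t ∈ Set.Icc a b, √(∫ x, ((deriv (fun s => u s x) t) ^ 2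
      + ∑ i, (pd i (u t) x) ^ 2)) ≤ √sphereArea * control (profile u) a b :=
    Real.iSup_le (fun t => Real.iSup_le (fun ht => sqrt_energy_le
      (H.integral_energy hR hu hrad ht) (n2_nonneg _) (h1 t ht).1) hsK) hsK
  have e4 : ⨆ t ∈ Set.Icc a b, √(∫ x, (∑ i, (deriv (fun s => pd i (u s) x) t) ^ 2
      + ∑ i, ∑ j, (pd j (pd i (u t)) x) ^ 2)) ≤ √sphereArea * control (profile u) a b :=
    Real.iSup_le (fun t => Real.iSup_le (fun ht => sqrt_energy_le
      (H.integral_energy_dr hR hu hrad ht) (n2_nonneg _) (h1 t ht).2.1) hsK) hsK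
  rw [Bquant]
  linarith

end RadialWave

/-- **Proposition (small `A` implies good bounds).** There are absolute constants
`ε₀, C₀ > 0` such that if `A ≤ ε₀ / log(2+D)` then `B ≤ C₀ D`; in particular
`‖∇_{t,x}u(t₁)‖_{H¹} ≤ C₀ ‖∇_{t,x}u(t₀)‖_{H¹}`. -/
theorem small_A_propagation :
    ∃ ε₀ > (0:ℝ), ∃ C₀ > (0:ℝ), ∀ (t₀ t₁ : ℝ), t₀ < t₁ → ∀ u : ℝ → Sp → ℝ,
      IsClassicalSolution (Set.Icc t₀ t₁) u →
      IsRadialSolution (Set.Icc t₀ t₁) u →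
      Aquant (Set.Icc t₀ t₁) u ≤ ε₀ / Real.log (2 + Dquant u t₀) →
      Bquant (Set.Icc t₀ t₁) u ≤ C₀ * Dquant u t₀ ∧
      Dquant u t₁ ≤ C₀ * Dquant u t₀ := by
  have hκ := sphereArea_pos
  have hs : 0 < √sphereArea := Real.sqrt_pos.2 hκ
  set c : ℝ := 4 / √sphereArea with hc
  have hc0 : 0 < c := by positivity
  set C₁ : ℝ := 2 * log (c + 2) / log 2 + 2 with hC₁
  have hC₁0 : 0 < C₁ := by
    have h1 := log_pos one_lt_two
    have h2 : 0 ≤ log (c + 2) := log_nonneg (by linarith)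
    positivity
  refine ⟨sphereArea / (2 * C₁ * 180 ^ 2), by positivity, 10 * c + 8, by positivity, ?_⟩
  intro t₀ t₁ hlt u hu hrad hA
  obtain ⟨R, hR, H⟩ := exists_radialWave_profile hu hrad hlt
  have hD : 0 ≤ Dquant u t₀ := Real.sqrt_nonneg _
  have hi := RadialWave.initial_nonneg (profile u) t₀
  have hiD := H.initial_le hR hu.1 hrad
  have h2i : 2 * RadialWave.initial (profile u) t₀ ≤ c * Dquant u t₀ := by
    rw [hc, div_mul_eq_mul_div, le_div_iff₀ hs]
    linarith
  have hlog : 0 < log (2 + Dquant u t₀) := log_pos (by linarith)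
  have hd : 0 ≤ ∫ t in t₀..t₁, density (profile u) t :=
    intervalIntegral.integral_nonneg hlt.le fun t _ => density_nonneg _ t
  have hcontrol : RadialWave.control (profile u) t₀ t₁
      ≤ 2 * RadialWave.initial (profile u) t₀ := by
    refine H.control_le_two_mul hR ?_
    rw [H.Aquant_eq hrad, le_div_iff₀ hlog, le_div_iff₀ (by positivity)] at hA
    refine (mul_le_mul_of_nonneg_right (log_two_add_sq_le hc0.le hD (by linarith) h2i) hd).trans ?_
    rw [← hC₁, le_div_iff₀ (by positivity)]
    refine le_of_mul_le_mul_left ?_ hκ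
    linarith
  have hcs : c * √sphereArea = 4 := div_mul_cancel₀ _ hs.ne'
  have hsD : √sphereArea * (2 * RadialWave.initial (profile u) t₀) ≤ 4 * Dquant u t₀ := by
    linarith
  have hsC := mul_le_mul_of_nonneg_left hcontrol hs.le
  have hcD : 0 ≤ c * Dquant u t₀ := by positivity
  constructor
  · have := H.Bquant_le hR hu.1 hrad
    linarith
  · have := H.Dquant_le hR hu.1 hrad (Set.right_mem_Icc.2 hlt.le)
    linarith
end
end

section
/- Fix constants ε₀ > 0 and C₀ > 1. Then there exists a constant C > 0 (depending only on ε₀ and C₀) such that for every real A ≥ 0 and D ≥ 0 there exists an integer N with 1 ≤ N ≤ C · (2+D)^{C·A} and Σ_{n=0}^{N} ε₀ / log(2 + C₀ⁿ · D) > A. -/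
open Real Finset

/-- Comparison of a harmonic-type sum along an arithmetic progression with the logarithm. -/
theorem log_sub_log_le_sum_div {L c : ℝ} (hL : 0 < L) (hc : 0 ≤ c) (m : ℕ) :
    Real.log (L + m * c) - Real.log L ≤ ∑ n ∈ Finset.range m, c / (L + n * c) := by
  induction m with
  | zero => simp
  | succ m ih =>
    rw [Finset.sum_range_succ]
    have hm : 0 < L + m * c := by positivity
    have hm' : 0 < L + (m + 1 : ℕ) * c := by positivity
    have h := Real.log_le_sub_one_of_pos (div_pos hm' hm)
    rw [Real.log_div hm'.ne' hm.ne'] at h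
    have he : (L + (m + 1 : ℕ) * c) / (L + m * c) - 1 = c / (L + m * c) := by
      rw [div_sub_one hm.ne']
      push_cast
      ring
    linarith

theorem log_two_add_pow_mul_le {C₀ D : ℝ} (hC₀ : 1 ≤ C₀) (hD : 0 ≤ D) (n : ℕ) :
    Real.log (2 + C₀ ^ n * D) ≤ Real.log (2 + D) + n * Real.log C₀ := by
  have hp : 1 ≤ C₀ ^ n := one_le_pow₀ hC₀
  rw [← Real.log_pow, ← Real.log_mul (by positivity) (by positivity)]
  exact Real.log_le_log (by positivity) (by linarith)

/-- For any `ε₀ > 0` and `C₀ > 1` there is a constant `C > 0` such that for all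
`A, D ≥ 0` one may find an integer `1 ≤ N ≤ C (2+D)^{C A}` with
`∑_{n=0}^{N} ε₀/log(2 + C₀ⁿ D) > A`. -/
theorem exists_N_sum_exceeds (ε₀ C₀ : ℝ) (hε₀ : 0 < ε₀) (hC₀ : 1 < C₀) :
    ∃ C > (0:ℝ), ∀ A D : ℝ, 0 ≤ A → 0 ≤ D →
      ∃ N : ℕ, 1 ≤ N ∧ (N : ℝ) ≤ C * (2 + D) ^ (C * A) ∧
        A < ∑ n ∈ Finset.range (N + 1), ε₀ / Real.log (2 + C₀ ^ n * D) := by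
  have hc : 0 < Real.log C₀ := Real.log_pos hC₀
  have hl2 : 0 < Real.log 2 := Real.log_pos one_lt_two
  set c := Real.log C₀ with hc_def
  set k := c / (ε₀ * Real.log 2) with hk_def
  have hk : 0 < k := by positivity
  have hε' : 0 < 1 / ε₀ := by positivity
  refine ⟨1 / ε₀ + 1 + (1 + k), by positivity, fun A D hA hD => ?_⟩
  set L := Real.log (2 + D) with hL_def
  have hL2 : Real.log 2 ≤ L := Real.log_le_log two_pos (by linarith)
  have hL : 0 < L := hl2.trans_le hL2
  set x := A * c / ε₀ with hx_def
  have hx : 0 ≤ x := by positivity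
  set T := L / c * (Real.exp x - 1) with hT_def
  have hT : 0 ≤ T := mul_nonneg (by positivity) (by linarith [Real.add_one_le_exp x])
  refine ⟨⌊T⌋₊ + 1, by omega, ?_, ?_⟩
  · have hAL : 0 ≤ A * L := by positivity
    have hxk : x ≤ k * (A * L) := by
      have : x = k * (A * Real.log 2) := by
        rw [hx_def, hk_def]
        field_simp
      rw [this]
      gcongr
    have hexp : Real.exp x - 1 ≤ x * Real.exp x := by
      have h1 := Real.add_one_le_exp (-x)
      have h2 : Real.exp (-x) * Real.exp x = 1 := by rw [← Real.exp_add]; simp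
      nlinarith [Real.exp_pos x]
    have hTle : T ≤ 1 / ε₀ * Real.exp ((1 + k) * (A * L)) := calc
      T ≤ L / c * (x * Real.exp x) := by rw [hT_def]; gcongr
      _ = 1 / ε₀ * ((A * L) * Real.exp x) := by rw [hx_def]; field_simp
      _ ≤ 1 / ε₀ * (Real.exp (A * L) * Real.exp (k * (A * L))) := by
        gcongr
        linarith [Real.add_one_le_exp (A * L)]
      _ = 1 / ε₀ * Real.exp ((1 + k) * (A * L)) := by rw [← Real.exp_add]; ring_nf
    have hone : 1 ≤ Real.exp ((1 + k) * (A * L)) := Real.one_le_exp (by positivity)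
    rw [Real.rpow_def_of_pos (by positivity), ← hL_def]
    push_cast
    calc (⌊T⌋₊ : ℝ) + 1 ≤ T + 1 := by gcongr; exact Nat.floor_le hT
      _ ≤ (1 / ε₀ + 1) * Real.exp ((1 + k) * (A * L)) := by linarith
      _ ≤ (1 / ε₀ + 1 + (1 + k)) * Real.exp (L * ((1 / ε₀ + 1 + (1 + k)) * A)) := by
        have hmono : (1 + k) * (A * L) ≤ L * ((1 / ε₀ + 1 + (1 + k)) * A) := by
          nlinarith [mul_nonneg hε'.le hAL]
        exact mul_le_mul (by linarith) (Real.exp_le_exp.mpr hmono) (Real.exp_pos _).le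
          (by positivity)
  · set m := ⌊T⌋₊ + 1 + 1 with hm_def
    have hm : T < m := by
      rw [hm_def]
      push_cast
      linarith [Nat.lt_floor_add_one T]
    have hlog : x < Real.log (L + m * c) - Real.log L := by
      rw [← Real.log_div (by positivity) hL.ne', Real.lt_log_iff_exp_lt (by positivity),
        lt_div_iff₀ hL]
      have hTc : T * c = L * (Real.exp x - 1) := by rw [hT_def]; field_simp
      nlinarith [mul_lt_mul_of_pos_right hm hc]
    calc A = ε₀ / c * x := by rw [hx_def]; field_simp
      _ < ε₀ / c * ∑ n ∈ Finset.range m, c / (L + n * c) := by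
        gcongr
        exact hlog.trans_le (log_sub_log_le_sum_div hL hc.le m)
      _ = ∑ n ∈ Finset.range m, ε₀ / (L + n * c) := by
        rw [Finset.mul_sum]
        refine Finset.sum_congr rfl fun n _ => ?_
        field_simp
      _ ≤ ∑ n ∈ Finset.range m, ε₀ / Real.log (2 + C₀ ^ n * D) := by
        refine Finset.sum_le_sum fun n _ => ?_
        have hpos : 0 ≤ C₀ ^ n * D := by positivity
        exact div_le_div_of_nonneg_left hε₀.le (Real.log_pos (by linarith))
          (log_two_add_pow_mul_le hC₀.le hD n)
end
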